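/- arXiv:2512.01269 — 4 statements merged into one kernel-verified Lean document; each statement's English description precedes it below -/
import Mathlib

section
/- Suppose η is a g-invariant Borel probability measure on X with η(R) = 1. Then both g(R) ⊆ R and g⁻¹(R) ⊆ R (so T(gⁿ(x)) is defined for every x ∈ R and every n ∈ ℤ), and for η-almost every x one has lim_{n→±∞} (1/|n|) · log T(gⁿ(x)) = 0; that is, T is tempered along the orbit of η-almost every point. (Lemma 3.8 of the paper, stated for the abstract resonance-block construction.) -/
open Set Filter Topology MeasureTheory
open scoped Classical

noncomputable section

variable {X : Type*}

/-- `n ∈ H_t`: equivalent to `a¹_n ≤ t ∧ a²_n ≤ t` in the resonance-block construction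
(all the defining ratios are bounded by `t`, products written multiplicatively since
`φE, φF > 0` and `cE, cF > 0`). -/
def memH (g : Equiv.Perm X) (x₀ : X) (φE φF : X → ℝ) (cE cF t : ℝ) (n : ℕ) : Prop :=
  (∀ j ≤ n,
      (∏ i ∈ Finset.Ico (n - j) n, φF ((g ^ i) x₀)) ≤ t * cF ^ j ∧
      cE ^ j ≤ t * ∏ i ∈ Finset.Ico (n - j) n, φE ((g ^ i) x₀)) ∧
  (∀ j : ℕ,
      (∏ i ∈ Finset.Ico n (n + j), φF ((g ^ i) x₀)) ≤ t * cF ^ j ∧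
      cE ^ j ≤ t * ∏ i ∈ Finset.Ico n (n + j), φE ((g ^ i) x₀))

/-- The resonance block `Λ_t = ⋂_{m ≥ 1} closure {gʲ(x₀) : j ∈ H_t, j ≥ m}`. -/
def block [TopologicalSpace X] (g : Equiv.Perm X) (x₀ : X) (φE φF : X → ℝ)
    (cE cF t : ℝ) : Set X :=
  ⋂ m ∈ {m : ℕ | 1 ≤ m},
    closure ((fun j : ℕ => (g ^ j) x₀) '' {j | memH g x₀ φE φF cE cF t j ∧ m ≤ j})

/-- `R = ⋃_{t ≥ 1} Λ_t`. -/
def blockUnion [TopologicalSpace X] (g : Equiv.Perm X) (x₀ : X) (φE φF : X → ℝ)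
    (cE cF : ℝ) : Set X :=
  ⋃ t ∈ {t : ℝ | 1 ≤ t}, block g x₀ φE φF cE cF t

/-- `T(x) = inf {t ≥ 1 : x ∈ Λ_t}`. -/
def Tfun [TopologicalSpace X] (g : Equiv.Perm X) (x₀ : X) (φE φF : X → ℝ)
    (cE cF : ℝ) (x : X) : ℝ :=
  sInf {t : ℝ | 1 ≤ t ∧ x ∈ block g x₀ φE φF cE cF t}

/-! ### A maximal ergodic inequality -/

/-- The largest of the Birkhoff sums of `h` along `f` of length at most `N`. -/
def maxBirkhoffSum (f : X → X) (h : X → ℝ) : ℕ → X → ℝ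
  | 0 => fun _ => 0
  | N + 1 => fun x => max 0 (h x + maxBirkhoffSum f h N (f x))

lemma maxBirkhoffSum_nonneg (f : X → X) (h : X → ℝ) (N : ℕ) (x : X) :
    0 ≤ maxBirkhoffSum f h N x := by
  cases N with
  | zero => exact le_rfl
  | succ N => exact le_max_left _ _

lemma maxBirkhoffSum_le_succ (f : X → X) (h : X → ℝ) (N : ℕ) (x : X) :
    maxBirkhoffSum f h N x ≤ maxBirkhoffSum f h (N + 1) x := by
  induction N generalizing x with
  | zero => exact maxBirkhoffSum_nonneg f h 1 x
  | succ N ih => exact max_le_max le_rfl (by linarith [ih (f x)])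

lemma birkhoffSum_le_maxBirkhoffSum (f : X → X) (h : X → ℝ) (N : ℕ) (x : X) :
    birkhoffSum f h N x ≤ maxBirkhoffSum f h N x := by
  induction N generalizing x with
  | zero => simp [maxBirkhoffSum]
  | succ N ih =>
    rw [birkhoffSum_succ']
    exact le_max_of_le_right (by linarith [ih (f x)])

lemma maxBirkhoffSum_le_of_pos {f : X → X} {h : X → ℝ} {N : ℕ} {x : X}
    (hx : 0 < maxBirkhoffSum f h N x) :
    maxBirkhoffSum f h N x ≤ h x + maxBirkhoffSum f h N (f x) := by
  cases N with
  | zero => exact absurd hx (lt_irrefl _)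
  | succ N =>
    have h1 := maxBirkhoffSum_le_succ f h N (f x)
    have h2 : maxBirkhoffSum f h (N + 1) x = max 0 (h x + maxBirkhoffSum f h N (f x)) := rfl
    rcases max_choice 0 (h x + maxBirkhoffSum f h N (f x)) with h3 | h3
    · rw [h2, h3] at hx
      exact absurd hx (lt_irrefl _)
    · rw [h2, h3]
      linarith

section Maximal

variable [MeasurableSpace X] {μ : Measure X} {f : X → X} {h : X → ℝ}

lemma measurable_maxBirkhoffSum (hf : Measurable f) (hh : Measurable h) (N : ℕ) :
    Measurable (maxBirkhoffSum f h N) := by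
  induction N with
  | zero => exact measurable_const
  | succ N ih => exact measurable_const.max (hh.add (ih.comp hf))

lemma integrable_maxBirkhoffSum (hf : MeasurePreserving f μ μ) (hh : Integrable h μ) (N : ℕ) :
    Integrable (maxBirkhoffSum f h N) μ := by
  induction N with
  | zero => exact integrable_zero _ _ _
  | succ N ih =>
    exact (integrable_zero X ℝ μ).sup (hh.add (hf.integrable_comp_of_integrable ih))

/-- The maximal ergodic theorem. -/
lemma setIntegral_maxBirkhoffSum_pos_nonneg (hf : MeasurePreserving f μ μ) (hm : Measurable h)
    (hh : Integrable h μ) (N : ℕ) :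
    0 ≤ ∫ x in {x | 0 < maxBirkhoffSum f h N x}, h x ∂μ := by
  set H := maxBirkhoffSum f h N with hH
  have hHm : Measurable H := measurable_maxBirkhoffSum hf.measurable hm N
  have hHi : Integrable H μ := integrable_maxBirkhoffSum hf hh N
  have hHfi : Integrable (fun x => H (f x)) μ := hf.integrable_comp_of_integrable hHi
  have hP : MeasurableSet {x | 0 < H x} := measurableSet_lt measurable_const hHm
  have hcomp : ∫ x, H (f x) ∂μ = ∫ x, H x ∂μ := by
    conv_rhs => rw [← hf.map_eq]
    exact (integral_map hf.aemeasurable hHm.aestronglyMeasurable).symm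
  have h1 : ∫ x in {x | 0 < H x}, H x ∂μ = ∫ x, H x ∂μ :=
    setIntegral_eq_integral_of_forall_compl_eq_zero fun x hx =>
      le_antisymm (not_lt.1 hx) (maxBirkhoffSum_nonneg f h N x)
  have h2 : ∫ x in {x | 0 < H x}, H (f x) ∂μ ≤ ∫ x, H (f x) ∂μ :=
    setIntegral_le_integral hHfi (Eventually.of_forall fun x => maxBirkhoffSum_nonneg f h N (f x))
  have h3 : ∫ x in {x | 0 < H x}, (H x - H (f x)) ∂μ ≤ ∫ x in {x | 0 < H x}, h x ∂μ :=
    setIntegral_mono_on (hHi.sub hHfi).integrableOn hh.integrableOn hP fun x hx => by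
      linarith [maxBirkhoffSum_le_of_pos (f := f) (h := h) (N := N) hx]
  rw [integral_sub hHi.integrableOn hHfi.integrableOn] at h3
  linarith

/-- The weak-type maximal inequality for the frequency of visits to a set. -/
lemma ofReal_mul_measure_exists_lt_birkhoffSum_le [IsProbabilityMeasure μ]
    (hf : MeasurePreserving f μ μ) {A : Set X} (hA : MeasurableSet A) {δ : ℝ} (hδ : 0 < δ) :
    ENNReal.ofReal δ * μ {x | ∃ n : ℕ, δ * n < birkhoffSum f (A.indicator 1) n x} ≤ μ A := by
  set h : X → ℝ := fun x => A.indicator 1 x - δ with hdef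
  have hi : Integrable (A.indicator (1 : X → ℝ)) μ :=
    (integrable_const (1 : ℝ)).indicator hA
  have hmi : Measurable (A.indicator (1 : X → ℝ)) := measurable_one.indicator hA
  have hh : Integrable h μ := hi.sub (integrable_const δ)
  have hm : Measurable h := hmi.sub measurable_const
  set P : ℕ → Set X := fun N => {x | 0 < maxBirkhoffSum f h N x} with hPdef
  have hPm : ∀ N, MeasurableSet (P N) := fun N =>
    measurableSet_lt measurable_const (measurable_maxBirkhoffSum hf.measurable hm N)
  have hmono : Monotone P := monotone_nat_of_le_succ fun N x hx =>
    lt_of_lt_of_le hx (maxBirkhoffSum_le_succ f h N x)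
  have hsub : {x | ∃ n : ℕ, δ * n < birkhoffSum f (A.indicator 1) n x} ⊆ ⋃ N, P N := by
    rintro x ⟨n, hn⟩
    refine mem_iUnion.2 ⟨n, lt_of_lt_of_le ?_ (birkhoffSum_le_maxBirkhoffSum f h n x)⟩
    have : birkhoffSum f h n x = birkhoffSum f (A.indicator 1) n x - δ * n := by
      simp [birkhoffSum, hdef, Finset.sum_sub_distrib, mul_comm]
    rw [this]
    linarith
  have hbound : ∀ N, μ (P N) ≤ μ A / ENNReal.ofReal δ := by
    intro N
    have h0 := setIntegral_maxBirkhoffSum_pos_nonneg hf hm hh N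
    rw [integral_sub hi.integrableOn (integrable_const δ).integrableOn,
      setIntegral_indicator hA] at h0
    simp only [Pi.one_apply, setIntegral_const, smul_eq_mul, mul_one] at h0
    have h1 : μ.real (P N ∩ A) ≤ μ.real A := measureReal_mono inter_subset_right
    rw [ENNReal.le_div_iff_mul_le (Or.inl (by simpa using hδ)) (Or.inl ENNReal.ofReal_ne_top),
      ← ofReal_measureReal (s := P N), ← ofReal_measureReal (s := A),
      ← ENNReal.ofReal_mul measureReal_nonneg]
    exact ENNReal.ofReal_le_ofReal (by linarith)
  calc ENNReal.ofReal δ * μ {x | ∃ n : ℕ, δ * n < birkhoffSum f (A.indicator 1) n x}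
      ≤ ENNReal.ofReal δ * (μ A / ENNReal.ofReal δ) := by
        gcongr
        refine (measure_mono hsub).trans ?_
        rw [hmono.measure_iUnion]
        exact iSup_le hbound
    _ ≤ μ A := ENNReal.mul_div_le

end Maximal

/-! ### Sublinear growth of functions with bounded increments along orbits -/

lemma tendsto_div_natCast_of_sparse {u : ℕ → ℝ} {L : ℝ} (h0 : ∀ n, 0 ≤ u n)
    (hL : ∀ n, u (n + 1) ≤ u n + L)
    (hfreq : ∀ δ : ℝ, 0 < δ → ∃ M : ℝ, ∀ n : ℕ,
      (((Finset.range n).filter fun j => M < u j).card : ℝ) ≤ δ * n) :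
    Tendsto (fun n : ℕ => u n / n) atTop (𝓝 0) := by
  wlog hLpos : 0 < L generalizing L
  · exact this (L := 1) (fun n => by linarith [hL n]) one_pos
  have hstep : ∀ k j, u (j + k) ≤ u j + L * k := by
    intro k j
    induction k with
    | zero => simp
    | succ k ih =>
      have := hL (j + k)
      push_cast
      rw [← add_assoc]
      linarith
  rw [Metric.tendsto_atTop]
  intro ε hε
  set κ : ℝ := min (ε / (2 * L)) 1 with hκ
  have hκpos : 0 < κ := by positivity
  have hκ1 : κ ≤ 1 := min_le_right _ _
  have hκL : L * κ ≤ ε / 2 := by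
    have : κ ≤ ε / (2 * L) := min_le_left _ _
    calc L * κ ≤ L * (ε / (2 * L)) := by gcongr
      _ = ε / 2 := by field_simp
  obtain ⟨M, hM⟩ := hfreq (κ / 2) (by positivity)
  obtain ⟨N₁, hN₁⟩ := exists_nat_gt (2 / κ)
  obtain ⟨N₂, hN₂⟩ := exists_nat_gt (2 * M / ε)
  refine ⟨max N₁ N₂, fun n hn => ?_⟩
  have hn1 : 2 / κ < n := hN₁.trans_le (by exact_mod_cast (le_max_left _ _).trans hn)
  have hn2 : 2 * M / ε < n := hN₂.trans_le (by exact_mod_cast (le_max_right _ _).trans hn)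
  have hnpos : (0 : ℝ) < n := lt_trans (by positivity) hn1
  rw [div_lt_iff₀ hκpos] at hn1
  rw [div_lt_iff₀ hε] at hn2
  rw [Real.dist_eq, sub_zero, abs_of_nonneg (div_nonneg (h0 n) hnpos.le), div_lt_iff₀ hnpos]
  by_contra! hu
  have hfl : (⌊κ * n⌋₊ : ℝ) ≤ κ * n := Nat.floor_le (by positivity)
  have hfl' : κ * n < ⌊κ * n⌋₊ + 1 := Nat.lt_floor_add_one _
  have hfn : ⌊κ * n⌋₊ ≤ n := by
    have : (⌊κ * n⌋₊ : ℝ) ≤ n := hfl.trans (by nlinarith)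
    exact_mod_cast this
  have hsub : Finset.Ico (n - ⌊κ * n⌋₊) n ⊆ (Finset.range n).filter fun j => M < u j := by
    intro j hj
    rw [Finset.mem_Ico] at hj
    rw [Finset.mem_filter, Finset.mem_range]
    refine ⟨hj.2, ?_⟩
    have h1 := hstep (n - j) j
    rw [Nat.add_sub_of_le hj.2.le] at h1
    have h2 : ((n - j : ℕ) : ℝ) ≤ κ * n := by
      refine le_trans ?_ hfl
      exact_mod_cast (by omega : n - j ≤ ⌊κ * n⌋₊)
    have h3 : L * ((n - j : ℕ) : ℝ) ≤ L * κ * n := by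
      rw [mul_assoc]
      gcongr
    have h4 : L * κ * n ≤ ε / 2 * n := by gcongr
    linarith
  have hcard := Finset.card_le_card hsub
  rw [Nat.card_Ico, Nat.sub_sub_self hfn] at hcard
  have hcard' : (⌊κ * n⌋₊ : ℝ) ≤ κ / 2 * n := le_trans (by exact_mod_cast hcard) (hM n)
  linarith

/-- A nonnegative function whose increments along orbits are bounded above grows sublinearly
along almost every orbit. -/
lemma ae_tendsto_iterate_div [MeasurableSpace X] {μ : Measure X} [IsProbabilityMeasure μ]
    {f : X → X} (hf : MeasurePreserving f μ μ) {u : X → ℝ} {L : ℝ}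
    (hu : Tendsto (fun k : ℕ => μ {x | (k : ℝ) < u x}) atTop (𝓝 0))
    (hstep : ∀ᵐ x ∂μ, ∀ n : ℕ, 0 ≤ u (f^[n] x) ∧ u (f^[n + 1] x) ≤ u (f^[n] x) + L) :
    ∀ᵐ x ∂μ, Tendsto (fun n : ℕ => u (f^[n] x) / n) atTop (𝓝 0) := by
  set A : ℕ → Set X := fun k => toMeasurable μ {x | (k : ℝ) < u x} with hA
  have hrare : ∀ δ : ℝ, 0 < δ → ∀ᵐ x ∂μ, ∃ k : ℕ, ∀ n : ℕ,
      birkhoffSum f ((A k).indicator 1) n x ≤ δ * n := by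
    intro δ hδ
    rw [ae_iff]
    set B : Set X := {x | ¬ ∃ k : ℕ, ∀ n : ℕ, birkhoffSum f ((A k).indicator 1) n x ≤ δ * n}
    have hB : ∀ k : ℕ, ENNReal.ofReal δ * μ B ≤ μ {x | (k : ℝ) < u x} := by
      intro k
      rw [← measure_toMeasurable {x | (k : ℝ) < u x}]
      refine le_trans ?_
        (ofReal_mul_measure_exists_lt_birkhoffSum_le hf (measurableSet_toMeasurable _ _) hδ)
      gcongr
      intro x hx
      simp only [B, mem_ofPred_eq, not_exists, not_forall, not_le] at hx
      exact hx k
    have h0 : ENNReal.ofReal δ * μ B ≤ 0 := ge_of_tendsto' hu hB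
    rcases mul_eq_zero.1 (le_antisymm h0 zero_le) with h | h
    · exact absurd (ENNReal.ofReal_eq_zero.1 h) (not_le.2 hδ)
    · exact h
  have hall : ∀ᵐ x ∂μ, ∀ m : ℕ, ∃ k : ℕ, ∀ n : ℕ,
      birkhoffSum f ((A k).indicator 1) n x ≤ 1 / ((m : ℝ) + 1) * n :=
    ae_all_iff.2 fun m => hrare _ (by positivity)
  filter_upwards [hall, hstep] with x hx hs
  refine tendsto_div_natCast_of_sparse (L := L) (fun n => (hs n).1) (fun n => (hs n).2) ?_
  intro δ hδ
  obtain ⟨m, hm⟩ := exists_nat_one_div_lt hδ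
  obtain ⟨k, hk⟩ := hx m
  refine ⟨k, fun n => le_trans ?_ ((hk n).trans (by gcongr))⟩
  rw [Finset.card_filter, birkhoffSum]
  push_cast
  refine Finset.sum_le_sum fun j _ => ?_
  split_ifs with hj
  · have : f^[j] x ∈ A k := subset_toMeasurable μ _ hj
    simp [this]
  · exact indicator_nonneg (fun _ _ => zero_le_one) _

/-! ### Resonance blocks -/

/-- All products of `a` over intervals of integers that end or start at `n` are at most `t`. -/
def ProdBound (a : ℕ → ℝ) (t : ℝ) (n : ℕ) : Prop :=
  (∀ j ≤ n, ∏ i ∈ Finset.Ico (n - j) n, a i ≤ t) ∧ ∀ j, ∏ i ∈ Finset.Ico n (n + j), a i ≤ t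

namespace ProdBound

variable {a : ℕ → ℝ} {t C : ℝ} {n : ℕ}

lemma one_le (h : ProdBound a t n) : 1 ≤ t := by simpa using h.2 0

lemma mono {s : ℝ} (h : ProdBound a t n) (hts : t ≤ s) : ProdBound a s n :=
  ⟨fun j hj => (h.1 j hj).trans hts, fun j => (h.2 j).trans hts⟩

lemma succ (ha : ∀ i, 0 < a i) (hC : ∀ i, a i ≤ C) (hC' : ∀ i, (a i)⁻¹ ≤ C) (hC1 : 1 ≤ C)
    (h : ProdBound a t n) : ProdBound a (C * t) (n + 1) := by
  have ht := h.one_le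
  refine ⟨fun j hj => ?_, fun j => ?_⟩
  · cases j with
    | zero => simpa using one_le_mul_of_one_le_of_one_le hC1 ht
    | succ k =>
      have h1 := h.1 k (by omega)
      rw [Nat.add_sub_add_right, Finset.prod_Ico_succ_top (Nat.sub_le _ _), mul_comm]
      exact mul_le_mul (hC n) h1 (Finset.prod_nonneg fun i _ => (ha i).le) (by linarith)
  · have h1 := h.2 (j + 1)
    rw [Finset.prod_eq_prod_Ico_succ_bot (by omega), ← add_assoc, add_right_comm] at h1
    calc ∏ i ∈ Finset.Ico (n + 1) (n + 1 + j), a i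
        = (a n)⁻¹ * (a n * ∏ i ∈ Finset.Ico (n + 1) (n + 1 + j), a i) := by
          rw [inv_mul_cancel_left₀ (ha n).ne']
      _ ≤ C * t := mul_le_mul (hC' n) h1
          (mul_nonneg (ha n).le (Finset.prod_nonneg fun i _ => (ha i).le)) (by linarith)

lemma of_succ (ha : ∀ i, 0 < a i) (hC : ∀ i, a i ≤ C) (hC' : ∀ i, (a i)⁻¹ ≤ C) (hC1 : 1 ≤ C)
    (h : ProdBound a t (n + 1)) : ProdBound a (C * t) n := by
  have ht := h.one_le
  refine ⟨fun j hj => ?_, fun j => ?_⟩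
  · have h1 := h.1 (j + 1) (by omega)
    rw [Nat.add_sub_add_right, Finset.prod_Ico_succ_top (Nat.sub_le _ _), mul_comm] at h1
    calc ∏ i ∈ Finset.Ico (n - j) n, a i
        = (a n)⁻¹ * (a n * ∏ i ∈ Finset.Ico (n - j) n, a i) := by
          rw [inv_mul_cancel_left₀ (ha n).ne']
      _ ≤ C * t := mul_le_mul (hC' n) h1
          (mul_nonneg (ha n).le (Finset.prod_nonneg fun i _ => (ha i).le)) (by linarith)
  · cases j with
    | zero => simpa using one_le_mul_of_one_le_of_one_le hC1 ht
    | succ k =>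
      have h1 := h.2 k
      rw [Finset.prod_eq_prod_Ico_succ_bot (by omega), ← add_assoc, add_right_comm]
      exact mul_le_mul (hC n) h1 (Finset.prod_nonneg fun i _ => (ha i).le) (by linarith)

end ProdBound

section Block

variable {g : Equiv.Perm X} {x₀ : X} {φE φF : X → ℝ} {cE cF t C : ℝ} {n : ℕ}

lemma memH_iff (hE : ∀ x, 0 < φE x) (hcF : 0 < cF) :
    memH g x₀ φE φF cE cF t n ↔
      ProdBound (fun i => φF ((g ^ i) x₀) / cF) t n ∧
        ProdBound (fun i => cE / φE ((g ^ i) x₀)) t n := by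
  have hF' : ∀ a b : ℕ, (∏ i ∈ Finset.Ico a b, φF ((g ^ i) x₀) / cF) ≤ t ↔
      (∏ i ∈ Finset.Ico a b, φF ((g ^ i) x₀)) ≤ t * cF ^ (b - a) := fun a b => by
    rw [Finset.prod_div_distrib, Finset.prod_const, Nat.card_Ico, div_le_iff₀ (by positivity)]
  have hE' : ∀ a b : ℕ, (∏ i ∈ Finset.Ico a b, cE / φE ((g ^ i) x₀)) ≤ t ↔
      cE ^ (b - a) ≤ t * ∏ i ∈ Finset.Ico a b, φE ((g ^ i) x₀) := fun a b => by
    rw [Finset.prod_div_distrib, Finset.prod_const, Nat.card_Ico,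
      div_le_iff₀ (Finset.prod_pos fun i _ => hE _)]
  simp only [ProdBound, memH, hF', hE', Nat.add_sub_cancel_left]
  constructor
  · rintro ⟨h1, h2⟩
    refine ⟨⟨fun j hj => ?_, fun j => (h2 j).1⟩, fun j hj => ?_, fun j => (h2 j).2⟩
    · rw [Nat.sub_sub_self hj]
      exact (h1 j hj).1
    · rw [Nat.sub_sub_self hj]
      exact (h1 j hj).2
  · rintro ⟨⟨h1, h2⟩, h3, h4⟩
    refine ⟨fun j hj => ?_, fun j => ⟨h2 j, h4 j⟩⟩
    have h5 := h1 j hj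
    have h6 := h3 j hj
    rw [Nat.sub_sub_self hj] at h5 h6
    exact ⟨h5, h6⟩

/-- `C` dominates `φF / cF`, `φE / cE` and their inverses. -/
structure RatioBound (φE φF : X → ℝ) (cE cF C : ℝ) : Prop where
  one_le : 1 ≤ C
  F_le : ∀ x, φF x / cF ≤ C
  F_inv_le : ∀ x, (φF x / cF)⁻¹ ≤ C
  E_le : ∀ x, cE / φE x ≤ C
  E_inv_le : ∀ x, (cE / φE x)⁻¹ ≤ C

lemma exists_ratioBound [TopologicalSpace X] [CompactSpace X] (hφE : Continuous φE)
    (hφF : Continuous φF) (hE : ∀ x, 0 < φE x) (hF : ∀ x, 0 < φF x) (hcE : 0 < cE)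
    (hcF : 0 < cF) : ∃ C, RatioBound φE φF cE cF C := by
  have key : ∀ f : X → ℝ, Continuous f → ∃ C, ∀ x, f x ≤ C := fun f hf => by
    obtain ⟨C, hC⟩ := isCompact_univ.exists_bound_of_continuousOn hf.continuousOn
    exact ⟨C, fun x => (Real.le_norm_self _).trans (hC x (mem_univ x))⟩
  have hF1 : Continuous fun x => φF x / cF := hφF.div_const cF
  have hE1 : Continuous fun x => cE / φE x := continuous_const.div hφE fun x => (hE x).ne'
  obtain ⟨C₁, h₁⟩ := key _ hF1
  obtain ⟨C₂, h₂⟩ := key _ (hF1.inv₀ fun x => (div_pos (hF x) hcF).ne')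
  obtain ⟨C₃, h₃⟩ := key _ hE1
  obtain ⟨C₄, h₄⟩ := key _ (hE1.inv₀ fun x => (div_pos hcE (hE x)).ne')
  exact ⟨max 1 (max (max C₁ C₂) (max C₃ C₄)), le_max_left _ _,
    fun x => by simp [h₁ x], fun x => by simpa using Or.inr (Or.inl (Or.inr (h₂ x))),
    fun x => by simp [h₃ x], fun x => by simpa using Or.inr (Or.inr (Or.inr (h₄ x)))⟩

lemma memH.succ (hE : ∀ x, 0 < φE x) (hF : ∀ x, 0 < φF x) (hcE : 0 < cE) (hcF : 0 < cF)
    (hC : RatioBound φE φF cE cF C) (h : memH g x₀ φE φF cE cF t n) :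
    memH g x₀ φE φF cE cF (C * t) (n + 1) := by
  rw [memH_iff hE hcF] at h ⊢
  exact ⟨h.1.succ (fun _ => div_pos (hF _) hcF) (fun _ => hC.F_le _) (fun _ => hC.F_inv_le _)
    hC.one_le, h.2.succ (fun _ => div_pos hcE (hE _)) (fun _ => hC.E_le _)
    (fun _ => hC.E_inv_le _) hC.one_le⟩

lemma memH.of_succ (hE : ∀ x, 0 < φE x) (hF : ∀ x, 0 < φF x) (hcE : 0 < cE) (hcF : 0 < cF)
    (hC : RatioBound φE φF cE cF C) (h : memH g x₀ φE φF cE cF t (n + 1)) :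
    memH g x₀ φE φF cE cF (C * t) n := by
  rw [memH_iff hE hcF] at h ⊢
  exact ⟨h.1.of_succ (fun _ => div_pos (hF _) hcF) (fun _ => hC.F_le _)
    (fun _ => hC.F_inv_le _) hC.one_le, h.2.of_succ (fun _ => div_pos hcE (hE _))
    (fun _ => hC.E_le _) (fun _ => hC.E_inv_le _) hC.one_le⟩

variable [TopologicalSpace X] {x : X}

lemma mem_block_iff : x ∈ block g x₀ φE φF cE cF t ↔ ∀ m : ℕ, 1 ≤ m →
    x ∈ closure ((fun j : ℕ => (g ^ j) x₀) '' {j | memH g x₀ φE φF cE cF t j ∧ m ≤ j}) := by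
  simp [block]

lemma mem_blockUnion_iff : x ∈ blockUnion g x₀ φE φF cE cF ↔
    ∃ t : ℝ, 1 ≤ t ∧ x ∈ block g x₀ φE φF cE cF t := by
  simp [blockUnion]

lemma isClosed_block : IsClosed (block g x₀ φE φF cE cF t) :=
  isClosed_biInter fun _ _ => isClosed_closure

lemma block_mono (hE : ∀ x, 0 < φE x) (hcF : 0 < cF) {s : ℝ} (hts : t ≤ s) :
    block g x₀ φE φF cE cF t ⊆ block g x₀ φE φF cE cF s := by
  intro x hx
  rw [mem_block_iff] at hx ⊢
  intro m hm
  refine closure_mono (image_mono ?_) (hx m hm)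
  rintro j ⟨hj, hmj⟩
  refine ⟨?_, hmj⟩
  have h := (memH_iff hE hcF).1 hj
  exact (memH_iff hE hcF).2 ⟨h.1.mono hts, h.2.mono hts⟩

lemma apply_mem_block (hg : Continuous g) (hE : ∀ x, 0 < φE x) (hF : ∀ x, 0 < φF x)
    (hcE : 0 < cE) (hcF : 0 < cF) (hC : RatioBound φE φF cE cF C)
    (hx : x ∈ block g x₀ φE φF cE cF t) : g x ∈ block g x₀ φE φF cE cF (C * t) := by
  rw [mem_block_iff] at hx ⊢
  intro m hm
  refine map_mem_closure hg (hx m hm) ?_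
  rintro _ ⟨j, ⟨hj, hmj⟩, rfl⟩
  exact ⟨j + 1, ⟨hj.succ hE hF hcE hcF hC, by omega⟩, by simp [pow_succ']⟩

lemma symm_apply_mem_block (hg : Continuous g.symm) (hE : ∀ x, 0 < φE x) (hF : ∀ x, 0 < φF x)
    (hcE : 0 < cE) (hcF : 0 < cF) (hC : RatioBound φE φF cE cF C)
    (hx : x ∈ block g x₀ φE φF cE cF t) : g.symm x ∈ block g x₀ φE φF cE cF (C * t) := by
  rw [mem_block_iff] at hx ⊢
  intro m hm
  refine map_mem_closure hg (hx (m + 1) (by omega)) ?_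
  rintro _ ⟨j, ⟨hj, hmj⟩, rfl⟩
  obtain ⟨k, rfl⟩ : ∃ k, j = k + 1 := ⟨j - 1, by omega⟩
  exact ⟨k, ⟨hj.of_succ hE hF hcE hcF hC, by omega⟩, by simp [pow_succ']⟩

lemma mapsTo_blockUnion {f : X → X} (hC1 : 1 ≤ C)
    (hf : ∀ t x, x ∈ block g x₀ φE φF cE cF t → f x ∈ block g x₀ φE φF cE cF (C * t)) :
    MapsTo f (blockUnion g x₀ φE φF cE cF) (blockUnion g x₀ φE φF cE cF) := by
  intro x hx
  obtain ⟨t, ht, hxt⟩ := mem_blockUnion_iff.1 hx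
  exact mem_blockUnion_iff.2 ⟨C * t, one_le_mul_of_one_le_of_one_le hC1 ht, hf t x hxt⟩

lemma Tfun_le (ht : 1 ≤ t) (hx : x ∈ block g x₀ φE φF cE cF t) :
    Tfun g x₀ φE φF cE cF x ≤ t :=
  csInf_le ⟨1, fun _ hs => hs.1⟩ ⟨ht, hx⟩

lemma one_le_Tfun (hx : x ∈ blockUnion g x₀ φE φF cE cF) : 1 ≤ Tfun g x₀ φE φF cE cF x :=
  le_csInf (mem_blockUnion_iff.1 hx) fun _ hs => hs.1

lemma Tfun_apply_le {f : X → X} (hC1 : 1 ≤ C)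
    (hf : ∀ t x, x ∈ block g x₀ φE φF cE cF t → f x ∈ block g x₀ φE φF cE cF (C * t))
    (hx : x ∈ blockUnion g x₀ φE φF cE cF) :
    Tfun g x₀ φE φF cE cF (f x) ≤ C * Tfun g x₀ φE φF cE cF x := by
  rw [← div_le_iff₀' (by linarith)]
  refine le_csInf (mem_blockUnion_iff.1 hx) fun s hs => ?_
  rw [div_le_iff₀' (by linarith)]
  exact Tfun_le (one_le_mul_of_one_le_of_one_le hC1 hs.1) (hf s x hs.2)

lemma blockUnion_eq_iUnion_nat (hE : ∀ x, 0 < φE x) (hcF : 0 < cF) :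
    blockUnion g x₀ φE φF cE cF = ⋃ k : ℕ, block g x₀ φE φF cE cF (Real.exp k) := by
  ext x
  rw [mem_blockUnion_iff, mem_iUnion]
  constructor
  · rintro ⟨t, ht, hx⟩
    obtain ⟨k, hk⟩ := exists_nat_ge t
    exact ⟨k, block_mono hE hcF (by linarith [Real.add_one_le_exp (k : ℝ)]) hx⟩
  · rintro ⟨k, hk⟩
    exact ⟨_, Real.one_le_exp (Nat.cast_nonneg k), hk⟩

lemma setOf_lt_log_Tfun_subset (k : ℕ) :
    {x | (k : ℝ) < Real.log (Tfun g x₀ φE φF cE cF x)} ⊆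
      (block g x₀ φE φF cE cF (Real.exp k))ᶜ := by
  intro x hx hxk
  have h1 := Tfun_le (Real.one_le_exp (Nat.cast_nonneg k)) hxk
  have h0 : 0 ≤ Tfun g x₀ φE φF cE cF x := Real.sInf_nonneg fun s hs => zero_le_one.trans hs.1
  have h2 : Real.log (Tfun g x₀ φE φF cE cF x) ≤ k := by
    rcases h0.eq_or_lt with h | h
    · simp [← h]
    · exact (Real.log_le_iff_le_exp h).2 h1
  exact not_lt.2 h2 hx

variable [MeasurableSpace X] [BorelSpace X] {η : Measure X} [IsProbabilityMeasure η]

lemma ae_mem_blockUnion (hE : ∀ x, 0 < φE x) (hcF : 0 < cF)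
    (hR : η (blockUnion g x₀ φE φF cE cF) = 1) :
    ∀ᵐ x ∂η, x ∈ blockUnion g x₀ φE φF cE cF := by
  refine (mem_ae_iff_prob_eq_one ?_).2 hR
  rw [blockUnion_eq_iUnion_nat hE hcF]
  exact MeasurableSet.iUnion fun k => isClosed_block.measurableSet

lemma tendsto_measure_lt_log_Tfun (hE : ∀ x, 0 < φE x) (hcF : 0 < cF)
    (hR : η (blockUnion g x₀ φE φF cE cF) = 1) :
    Tendsto (fun k : ℕ => η {x | (k : ℝ) < Real.log (Tfun g x₀ φE φF cE cF x)}) atTop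
      (𝓝 0) := by
  have h := tendsto_measure_iInter_atTop (μ := η)
    (s := fun k : ℕ => (block g x₀ φE φF cE cF (Real.exp k))ᶜ)
    (fun k => isClosed_block.measurableSet.compl.nullMeasurableSet)
    (fun k l hkl => compl_subset_compl.2
      (block_mono hE hcF (Real.exp_le_exp.2 (Nat.cast_le.2 hkl))))
    ⟨0, measure_ne_top _ _⟩
  rw [← compl_iUnion, ← blockUnion_eq_iUnion_nat hE hcF,
    show η (blockUnion g x₀ φE φF cE cF)ᶜ = 0 from ae_mem_blockUnion hE hcF hR] at h
  exact tendsto_of_tendsto_of_tendsto_of_le_of_le tendsto_const_nhds h (fun _ => zero_le)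
    fun k => measure_mono (setOf_lt_log_Tfun_subset k)

lemma ae_tendsto_log_Tfun_iterate {f : X → X} (hfη : MeasurePreserving f η η)
    (hE : ∀ x, 0 < φE x) (hcF : 0 < cF) (hR : η (blockUnion g x₀ φE φF cE cF) = 1)
    (hC1 : 1 ≤ C)
    (hf : ∀ t x, x ∈ block g x₀ φE φF cE cF t → f x ∈ block g x₀ φE φF cE cF (C * t)) :
    ∀ᵐ x ∂η, Tendsto (fun n : ℕ => Real.log (Tfun g x₀ φE φF cE cF (f^[n] x)) / n) atTop
      (𝓝 0) := by
  refine ae_tendsto_iterate_div (u := fun x => Real.log (Tfun g x₀ φE φF cE cF x))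
    (L := Real.log C) hfη (tendsto_measure_lt_log_Tfun hE hcF hR) ?_
  filter_upwards [ae_mem_blockUnion hE hcF hR] with x hx n
  have hn : f^[n] x ∈ blockUnion g x₀ φE φF cE cF := (mapsTo_blockUnion hC1 hf).iterate n hx
  have hn' : f (f^[n] x) ∈ blockUnion g x₀ φE φF cE cF := mapsTo_blockUnion hC1 hf hn
  have h1 := one_le_Tfun hn
  have h1' := one_le_Tfun hn'
  refine ⟨Real.log_nonneg h1, ?_⟩
  rw [Function.iterate_succ_apply', add_comm, ← Real.log_mul (by positivity) (by positivity)]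
  exact Real.log_le_log (by linarith) (Tfun_apply_le hC1 hf hn)

end Block

/-- Lemma 3.8: if `η` is a `g`-invariant Borel probability measure with `η(R) = 1`, then
`R` is both forward and backward invariant under `g`, and `T` is tempered along the
orbit of `η`-almost every point: `(1/|n|)·log T(gⁿ(x)) → 0` as `n → ±∞`. -/
theorem stmt_5 [MetricSpace X] [CompactSpace X] [MeasurableSpace X] [BorelSpace X]
    (g : Equiv.Perm X) (hg : Continuous ⇑g) (hg' : Continuous ⇑g.symm)
    (x₀ : X) (φE φF : X → ℝ) (hφE : Continuous φE) (hφF : Continuous φF)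
    (hφEpos : ∀ x, 0 < φE x) (hφFpos : ∀ x, 0 < φF x)
    (cE cF : ℝ) (hcE : 0 < cE) (hcF : 0 < cF)
    (η : Measure X) [IsProbabilityMeasure η] (hη : MeasurePreserving (⇑g) η η)
    (hR : η (blockUnion g x₀ φE φF cE cF) = 1) :
    ⇑g '' blockUnion g x₀ φE φF cE cF ⊆ blockUnion g x₀ φE φF cE cF ∧
    ⇑g ⁻¹' blockUnion g x₀ φE φF cE cF ⊆ blockUnion g x₀ φE φF cE cF ∧
    ∀ᵐ x ∂η,
      Tendsto (fun n : ℤ =>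
          Real.log (Tfun g x₀ φE φF cE cF ((g ^ n) x)) / |(n : ℝ)|) atTop (𝓝 0) ∧
      Tendsto (fun n : ℤ =>
          Real.log (Tfun g x₀ φE φF cE cF ((g ^ n) x)) / |(n : ℝ)|) atBot (𝓝 0) := by
  obtain ⟨C, hC⟩ := exists_ratioBound hφE hφF hφEpos hφFpos hcE hcF
  have hfwd : ∀ t x, x ∈ block g x₀ φE φF cE cF t → g x ∈ block g x₀ φE φF cE cF (C * t) :=
    fun _ _ => apply_mem_block hg hφEpos hφFpos hcE hcF hC
  have hbwd : ∀ t x, x ∈ block g x₀ φE φF cE cF t →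
      g.symm x ∈ block g x₀ φE φF cE cF (C * t) :=
    fun _ _ => symm_apply_mem_block hg' hφEpos hφFpos hcE hcF hC
  have hη' : MeasurePreserving g.symm η η :=
    MeasurePreserving.symm (⟨g, hg.measurable, hg'.measurable⟩ : X ≃ᵐ X) hη
  refine ⟨(mapsTo_blockUnion hC.one_le hfwd).image_subset, fun x hx => ?_, ?_⟩
  · simpa using mapsTo_blockUnion hC.one_le hbwd hx
  filter_upwards [ae_tendsto_log_Tfun_iterate hη hφEpos hcF hR hC.one_le hfwd,
    ae_tendsto_log_Tfun_iterate hη' hφEpos hcF hR hC.one_le hbwd] with x h₁ h₂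
  constructor
  · rw [← Nat.map_cast_int_atTop, tendsto_map'_iff]
    refine h₁.congr fun n => ?_
    simp [← Equiv.Perm.iterate_eq_pow]
  · rw [← neg_atTop, ← Filter.map_neg, ← Nat.map_cast_int_atTop, map_map, tendsto_map'_iff]
    refine h₂.congr fun n => ?_
    simp [← inv_pow, ← Equiv.Perm.iterate_eq_pow, Equiv.Perm.inv_def]
end
end

section
/- For every real t ≥ 1, every x ∈ Λ_t, and every integer k ≥ 1 the following four estimates hold: (1) ∏_{i=−k}^{−1} φ_E(gⁱ(x)) ≥ t⁻¹ · c_E^k; (2) ∏_{i=0}^{k−1} φ_E(gⁱ(x)) ≥ t⁻¹ · c_E^k; (3) ∏_{i=−k}^{−1} φ_F(gⁱ(x)) ≤ t · c_F^k; (4) ∏_{i=0}^{k−1} φ_F(gⁱ(x)) ≤ t · c_F^k. (Corollary 3.10 of the paper, stated for the abstract resonance-block construction.) -/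
open Set Filter Topology MeasureTheory
open scoped Classical

noncomputable section

variable {X : Type*}

/-- A power of a permutation is continuous when the permutation and its inverse are. -/
theorem Equiv.Perm.continuous_zpow [TopologicalSpace X] {g : Equiv.Perm X}
    (hg : Continuous ⇑g) (hg' : Continuous ⇑g.symm) (n : ℤ) : Continuous ⇑(g ^ n) := by
  have hpow (f : Equiv.Perm X) (hf : Continuous ⇑f) (k : ℕ) : Continuous ⇑(f ^ k) := by
    rw [Equiv.Perm.coe_pow]
    exact hf.iterate k
  obtain ⟨k, rfl | rfl⟩ := n.eq_nat_or_neg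
  · simpa using hpow g hg k
  · rw [zpow_neg, zpow_natCast, ← inv_pow]
    exact hpow g⁻¹ hg' k

/-- The product of `φ` over the `k` points of the orbit of `x₀` preceding time `n` is the
backward product at `g ^ n x₀`. -/
theorem prod_Icc_orbit_eq (g : Equiv.Perm X) (x₀ : X) (φ : X → ℝ) {k n : ℕ} (hkn : k ≤ n) :
    ∏ i ∈ Finset.Icc 1 k, φ ((g ^ (-(i : ℤ))) ((g ^ n) x₀)) =
      ∏ i ∈ Finset.Ico (n - k) n, φ ((g ^ i) x₀) := by
  refine Finset.prod_bij' (fun i _ => n - i) (fun i _ => n - i) ?_ ?_ ?_ ?_ ?_ <;>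
    simp only [Finset.mem_Icc, Finset.mem_Ico]
  iterate 4 intros; omega
  intro i hi
  rw [← Equiv.Perm.mul_apply, ← zpow_natCast, ← zpow_add, ← zpow_natCast]
  congr 3
  omega

/-- The product of `φ` over the `k` points of the orbit of `x₀` starting at time `n` is the
forward product at `g ^ n x₀`. -/
theorem prod_range_orbit_eq (g : Equiv.Perm X) (x₀ : X) (φ : X → ℝ) (k n : ℕ) :
    ∏ i ∈ Finset.range k, φ ((g ^ i) ((g ^ n) x₀)) =
      ∏ i ∈ Finset.Ico n (n + k), φ ((g ^ i) x₀) := by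
  rw [Finset.prod_Ico_eq_prod_range, Nat.add_sub_cancel_left]
  refine Finset.prod_congr rfl fun i _ => ?_
  rw [← Equiv.Perm.mul_apply, ← pow_add, add_comm]

/-- A closed set containing `g ^ n x₀` for all sufficiently large `n ∈ H_t` contains `Λ_t`. -/
theorem block_subset_of_isClosed [TopologicalSpace X] {g : Equiv.Perm X} {x₀ : X}
    {φE φF : X → ℝ} {cE cF t : ℝ} {S : Set X} (hS : IsClosed S) {m : ℕ} (hm : 1 ≤ m)
    (h : ∀ n, memH g x₀ φE φF cE cF t n → m ≤ n → (g ^ n) x₀ ∈ S) :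
    block g x₀ φE φF cE cF t ⊆ S := by
  refine (biInter_subset_of_mem (show m ∈ {m : ℕ | 1 ≤ m} from hm)).trans
    (closure_minimal ?_ hS)
  rintro _ ⟨n, ⟨hn, hmn⟩, rfl⟩
  exact h n hn hmn

/-- Corollary 3.10: for every `t ≥ 1`, every `x ∈ Λ_t`, and every `k ≥ 1`, the backward
and forward products of `φE` along the orbit of `x` are bounded below by `t⁻¹·c_E^k`,
and those of `φF` are bounded above by `t·c_F^k`. -/
theorem stmt_7 [MetricSpace X] [CompactSpace X]
    (g : Equiv.Perm X) (hg : Continuous ⇑g) (hg' : Continuous ⇑g.symm)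
    (x₀ : X) (φE φF : X → ℝ) (hφE : Continuous φE) (hφF : Continuous φF)
    (hφEpos : ∀ x, 0 < φE x) (hφFpos : ∀ x, 0 < φF x)
    (cE cF : ℝ) (hcE : 0 < cE) (hcF : 0 < cF) :
    ∀ t : ℝ, 1 ≤ t → ∀ x ∈ block g x₀ φE φF cE cF t, ∀ k : ℕ, 1 ≤ k →
      t⁻¹ * cE ^ k ≤ ∏ i ∈ Finset.Icc 1 k, φE ((g ^ (-(i : ℤ))) x) ∧
      t⁻¹ * cE ^ k ≤ ∏ i ∈ Finset.range k, φE ((g ^ i) x) ∧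
      (∏ i ∈ Finset.Icc 1 k, φF ((g ^ (-(i : ℤ))) x)) ≤ t * cF ^ k ∧
      (∏ i ∈ Finset.range k, φF ((g ^ i) x)) ≤ t * cF ^ k := by
  intro t ht x hx k hk
  have ht₀ : 0 < t := zero_lt_one.trans_le ht
  have hz := Equiv.Perm.continuous_zpow hg hg'
  have hback {φ : X → ℝ} (hφ : Continuous φ) :
      Continuous fun y => ∏ i ∈ Finset.Icc 1 k, φ ((g ^ (-(i : ℤ))) y) :=
    continuous_finsetProd _ fun i _ => hφ.comp (hz _)
  have hforw {φ : X → ℝ} (hφ : Continuous φ) :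
      Continuous fun y => ∏ i ∈ Finset.range k, φ ((g ^ i) y) :=
    continuous_finsetProd _ fun i _ => hφ.comp (by simpa using hz i)
  refine ⟨?_, ?_, ?_, ?_⟩
  · refine block_subset_of_isClosed (isClosed_le continuous_const (hback hφE)) hk ?_ hx
    intro n hn hkn
    rw [mem_ofPred_eq, prod_Icc_orbit_eq g x₀ φE hkn, inv_mul_le_iff₀ ht₀]
    exact (hn.1 k hkn).2
  · refine block_subset_of_isClosed (isClosed_le continuous_const (hforw hφE)) hk ?_ hx
    intro n hn _
    rw [mem_ofPred_eq, prod_range_orbit_eq, inv_mul_le_iff₀ ht₀]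
    exact (hn.2 k).2
  · refine block_subset_of_isClosed (isClosed_le (hback hφF) continuous_const) hk ?_ hx
    intro n hn hkn
    rw [mem_ofPred_eq, prod_Icc_orbit_eq g x₀ φF hkn]
    exact (hn.1 k hkn).1
  · refine block_subset_of_isClosed (isClosed_le (hforw hφF) continuous_const) hk ?_ hx
    intro n hn _
    rw [mem_ofPred_eq, prod_range_orbit_eq]
    exact (hn.2 k).1
end
end

section
/- Let X be a compact metric space, f : X → X a homeomorphism, and μ an f-invariant, f-ergodic Borel probability measure. Let {φ_n}_{n≥1} and {ψ_n}_{n≥1} be sequences of continuous functions X → ℝ, each subadditive (φ_{n+m}(x) ≤ φ_n(x) + φ_m(fⁿ(x)) and ψ_{n+m}(x) ≤ ψ_n(x) + ψ_m(fⁿ(x)) for all n, m ≥ 1, x ∈ X), and let χ_F, χ_E ∈ ℝ be constants such that for μ-almost every x the limits lim_{n→∞} φ_n(x)/n and lim_{n→∞} ψ_n(x)/n exist and satisfy lim φ_n(x)/n ≤ χ_F and lim ψ_n(x)/n ≤ −χ_E. Then for every ε > 0 there exist an integer N ≥ 1, an f^N-invariant and f^N-ergodic Borel probability measure ν that is absolutely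 continuous with respect to μ, and a point x₀ ∈ X that is ν-generic for g := f^N, such that for the resonance blocks Λ_t built from the data (g, x₀, φ_F := exp(φ_N), φ_E := exp(−ψ_N), c_F := e^{N(χ_F+ε)}, c_E := e^{N(χ_E−ε)}) one has ν(⋃_{t ≥ 1} Λ_t) = 1 and ν(Λ_t) → 1 as t → ∞. (Proposition 3.11 of the paper, stated for the abstract resonance-block construction.) -/
open Set Filter Topology MeasureTheory
open scoped Classical

noncomputable section

variable {X : Type*}

namespace MeasureTheory

/-- Running maximum `max (0, S₁ h, …, Sₙ h)` of Birkhoff sums, defined recursively. -/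
def birkhoffMax (T : X → X) (h : X → ℝ) : ℕ → X → ℝ
  | 0 => fun _ => 0
  | n + 1 => fun x => max 0 (h x + birkhoffMax T h n (T x))

lemma birkhoffMax_nonneg (T : X → X) (h : X → ℝ) (n : ℕ) (x : X) :
    0 ≤ birkhoffMax T h n x := by
  cases n with
  | zero => exact le_rfl
  | succ n => exact le_max_left _ _

lemma birkhoffMax_le_succ (T : X → X) (h : X → ℝ) (n : ℕ) (x : X) :
    birkhoffMax T h n x ≤ birkhoffMax T h (n + 1) x := by
  induction n generalizing x with
  | zero => exact birkhoffMax_nonneg T h 1 x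
  | succ n ih =>
    simp only [birkhoffMax] at ih ⊢
    gcongr
    exact ih (T x)

lemma monotone_birkhoffMax (T : X → X) (h : X → ℝ) (x : X) :
    Monotone fun n => birkhoffMax T h n x :=
  monotone_nat_of_le_succ fun n => birkhoffMax_le_succ T h n x

lemma birkhoffSum_le_birkhoffMax (T : X → X) (h : X → ℝ) (n : ℕ) (x : X) :
    birkhoffSum T h n x ≤ birkhoffMax T h n x := by
  induction n generalizing x with
  | zero => simp [birkhoffMax]
  | succ n ih =>
    rw [birkhoffSum_succ']
    exact (add_le_add_right (ih (T x)) (h x)).trans (le_max_right _ _)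

lemma birkhoffMax_succ_sub (T : X → X) (h : X → ℝ) (n : ℕ) (x : X) :
    birkhoffMax T h (n + 1) x - birkhoffMax T h n (T x)
      = max (-birkhoffMax T h n (T x)) (h x) := by
  simp only [birkhoffMax]
  rw [max_sub_sub_right _ _ _ |>.symm]
  simp

lemma bddAbove_birkhoffMax_comp_iff (T : X → X) (h : X → ℝ) (x : X) :
    BddAbove (range fun n => birkhoffMax T h n (T x)) ↔
      BddAbove (range fun n => birkhoffMax T h n x) := by
  constructor
  · rintro ⟨K, hK⟩
    refine ⟨max 0 (h x + K), ?_⟩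
    rintro _ ⟨n, rfl⟩
    refine (birkhoffMax_le_succ T h n x).trans ?_
    simp only [birkhoffMax]
    gcongr
    exact hK ⟨n, rfl⟩
  · rintro ⟨K, hK⟩
    refine ⟨K - h x, ?_⟩
    rintro _ ⟨n, rfl⟩
    have h1 : birkhoffMax T h (n + 1) x ≤ K := hK ⟨n + 1, rfl⟩
    have h2 : h x + birkhoffMax T h n (T x) ≤ birkhoffMax T h (n + 1) x := le_max_right _ _
    simp only
    linarith

variable [MeasurableSpace X]

lemma measurable_birkhoffMax {T : X → X} (hT : Measurable T) {h : X → ℝ} (hh : Measurable h)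
    (n : ℕ) : Measurable (birkhoffMax T h n) := by
  induction n with
  | zero => exact measurable_const
  | succ n ih => exact measurable_const.max (hh.add (ih.comp hT))

lemma integrable_birkhoffMax {ν : Measure X} [IsFiniteMeasure ν] {T : X → X}
    (hT : MeasurePreserving T ν ν) {h : X → ℝ} (hi : Integrable h ν) (n : ℕ) :
    Integrable (birkhoffMax T h n) ν := by
  induction n with
  | zero => exact integrable_const 0
  | succ n ih => exact (integrable_const 0).sup (hi.add (hT.integrable_comp_of_integrable ih))

/-- Birkhoff sums of a function of negative mean over an ergodic system are almost surely
bounded above. -/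
theorem ae_bddAbove_birkhoffSum {ν : Measure X} [IsProbabilityMeasure ν] {T : X → X}
    (hT : Ergodic T ν) {h : X → ℝ} (hh : Measurable h) (hi : Integrable h ν)
    (hneg : ∫ x, h x ∂ν < 0) :
    ∀ᵐ x ∂ν, BddAbove (range fun n => birkhoffSum T h n x) := by
  have hmp := hT.toMeasurePreserving
  set A : Set X := {x | BddAbove (range fun n => birkhoffMax T h n x)} with hA
  have hAm : MeasurableSet A :=
    measurableSet_bddAbove_range fun n => measurable_birkhoffMax hmp.measurable hh n
  have hAinv : T ⁻¹' A = A := by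
    ext x
    exact bddAbove_birkhoffMax_comp_iff T h x
  rcases hT.toPreErgodic.ae_mem_or_ae_notMem hAm hAinv with hmem | hnot
  · filter_upwards [hmem] with x ⟨K, hK⟩
    refine ⟨K, ?_⟩
    rintro _ ⟨n, rfl⟩
    exact (birkhoffSum_le_birkhoffMax T h n x).trans (hK ⟨n, rfl⟩)
  · exfalso
    have hint := integrable_birkhoffMax hmp hi
    have hcomp n : Integrable (fun x => birkhoffMax T h n (T x)) ν :=
      hmp.integrable_comp_of_integrable (hint n)
    have hlim : Tendsto
        (fun n => ∫ x, birkhoffMax T h (n + 1) x - birkhoffMax T h n (T x) ∂ν)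
        atTop (𝓝 (∫ x, h x ∂ν)) := by
      refine tendsto_integral_of_dominated_convergence (fun x => |h x|)
        (fun n => ((hint (n + 1)).sub (hcomp n)).aestronglyMeasurable) hi.abs ?_ ?_
      · refine fun n => Eventually.of_forall fun x => ?_
        rw [birkhoffMax_succ_sub, Real.norm_eq_abs, abs_le]
        have h0 := birkhoffMax_nonneg T h n (T x)
        exact ⟨(neg_abs_le _).trans (le_max_right _ _),
          max_le (by linarith [abs_nonneg (h x)]) (le_abs_self _)⟩
      · filter_upwards [hnot] with x hx
        have hx' : ¬ BddAbove (range fun n => birkhoffMax T h n (T x)) := by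
          rwa [bddAbove_birkhoffMax_comp_iff]
        have htop : Tendsto (fun n => birkhoffMax T h n (T x)) atTop atTop := by
          refine tendsto_atTop_atTop_of_monotone (monotone_birkhoffMax T h (T x)) fun b => ?_
          by_contra! hb
          exact hx' ⟨b, by rintro _ ⟨n, rfl⟩; exact (hb n).le⟩
        refine tendsto_const_nhds.congr' ?_
        filter_upwards [htop.eventually_ge_atTop (-h x)] with n hn
        rw [birkhoffMax_succ_sub, max_eq_right (by linarith)]
    refine hneg.not_ge (ge_of_tendsto' hlim fun n => ?_)
    have hTint : ∫ x, birkhoffMax T h n (T x) ∂ν = ∫ x, birkhoffMax T h n x ∂ν := by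
      have := integral_map (μ := ν) hmp.measurable.aemeasurable
        (f := birkhoffMax T h n) (by rw [hmp.map_eq]; exact (hint n).aestronglyMeasurable)
      rw [hmp.map_eq] at this
      exact this.symm
    rw [integral_sub (hint (n + 1)) (hcomp n), hTint, sub_nonneg]
    exact integral_mono (hint n) (hint (n + 1)) (birkhoffMax_le_succ T h n)

lemma ae_eventually_birkhoffSum_div_lt {ν : Measure X} [IsProbabilityMeasure ν] {T : X → X}
    (hT : Ergodic T ν) {h : X → ℝ} (hh : Measurable h) (hi : Integrable h ν) {c : ℝ}
    (hc : ∫ x, h x ∂ν < c) :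
    ∀ᵐ x ∂ν, ∀ᶠ n : ℕ in atTop, birkhoffSum T h n x / n < c := by
  obtain ⟨d, hd, hdc⟩ := exists_between hc
  have hneg : ∫ x, (h x - d) ∂ν < 0 := by
    rw [integral_sub hi (integrable_const d)]
    simpa using hd
  filter_upwards [ae_bddAbove_birkhoffSum hT (hh.sub_const d) (hi.sub (integrable_const d)) hneg]
    with x ⟨K, hK⟩
  have hlim : Tendsto (fun n : ℕ => K / (n : ℝ)) atTop (𝓝 0) :=
    tendsto_const_div_atTop_nhds_zero_nat K
  filter_upwards [hlim.eventually_lt_const (sub_pos.2 hdc), eventually_gt_atTop 0] with n hn hn0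
  have hnpos : (0 : ℝ) < n := by exact_mod_cast hn0
  have h1 : birkhoffSum T (fun x => h x - d) n x ≤ K := hK ⟨n, rfl⟩
  have h2 : birkhoffSum T (fun x => h x - d) n x = birkhoffSum T h n x - n * d := by
    simp [birkhoffSum]
  rw [div_lt_iff₀ hnpos] at hn ⊢
  linarith

/-- Birkhoff's pointwise ergodic theorem for ergodic probability measures. -/
theorem ae_tendsto_birkhoffSum_div {ν : Measure X} [IsProbabilityMeasure ν] {T : X → X}
    (hT : Ergodic T ν) {h : X → ℝ} (hh : Measurable h) (hi : Integrable h ν) :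
    ∀ᵐ x ∂ν, Tendsto (fun n : ℕ => birkhoffSum T h n x / n) atTop (𝓝 (∫ x, h x ∂ν)) := by
  have hup (k : ℕ) : ∀ᵐ x ∂ν, ∀ᶠ n : ℕ in atTop,
      birkhoffSum T h n x / n < ∫ x, h x ∂ν + 1 / ((k : ℝ) + 1) :=
    ae_eventually_birkhoffSum_div_lt hT hh hi (lt_add_of_pos_right _ Nat.one_div_pos_of_nat)
  have hlo (k : ℕ) : ∀ᵐ x ∂ν, ∀ᶠ n : ℕ in atTop,
      birkhoffSum T (fun x => -h x) n x / n < ∫ x, -h x ∂ν + 1 / ((k : ℝ) + 1) :=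
    ae_eventually_birkhoffSum_div_lt hT hh.neg hi.neg
      (lt_add_of_pos_right _ Nat.one_div_pos_of_nat)
  filter_upwards [ae_all_iff.2 hup, ae_all_iff.2 hlo] with x hx1 hx2
  rw [Metric.tendsto_atTop']
  intro e he
  obtain ⟨k, hk⟩ := exists_nat_one_div_lt he
  obtain ⟨n₀, hn₀⟩ := eventually_atTop.1 ((hx1 k).and (hx2 k))
  refine ⟨n₀, fun n hn => ?_⟩
  obtain ⟨h1, h2⟩ := hn₀ n hn.le
  have h3 : birkhoffSum T (fun x => -h x) n x = -birkhoffSum T h n x := by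
    simp [birkhoffSum]
  rw [h3, neg_div, integral_neg] at h2
  rw [Real.dist_eq, abs_lt]
  constructor <;> linarith

/-- For an ergodic measure on a compact metric space almost every point is generic. -/
theorem ae_forall_continuous_tendsto_birkhoffSum_div {Y : Type*} [MetricSpace Y] [CompactSpace Y]
    [MeasurableSpace Y] [BorelSpace Y] {ν : Measure Y} [IsProbabilityMeasure ν] {T : Y → Y}
    (hT : Ergodic T ν) :
    ∀ᵐ x ∂ν, ∀ h : Y → ℝ, Continuous h →
      Tendsto (fun n : ℕ => birkhoffSum T h n x / n) atTop (𝓝 (∫ x, h x ∂ν)) := by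
  have hint (h : C(Y, ℝ)) : Integrable h ν :=
    h.continuous.integrable_of_hasCompactSupport (HasCompactSupport.of_compactSpace h)
  have hdense := TopologicalSpace.denseRange_denseSeq C(Y, ℝ)
  have hae := ae_all_iff.2 fun k => ae_tendsto_birkhoffSum_div hT
    (TopologicalSpace.denseSeq C(Y, ℝ) k).continuous.measurable
    (hint (TopologicalSpace.denseSeq C(Y, ℝ) k))
  filter_upwards [hae] with x hx h hh
  rw [Metric.tendsto_atTop']
  intro e he
  obtain ⟨k, hk⟩ := hdense.exists_dist_lt ⟨h, hh⟩ (show 0 < e / 3 by positivity)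
  set q := TopologicalSpace.denseSeq C(Y, ℝ) k
  have hq (y : Y) : |h y - q y| ≤ e / 3 :=
    (ContinuousMap.dist_apply_le_dist (f := ⟨h, hh⟩) (g := q) y).trans hk.le
  obtain ⟨n₀, hn₀⟩ := Metric.tendsto_atTop'.1 (hx k) (e / 3) (by positivity)
  refine ⟨n₀, fun n hn => ?_⟩
  have hn0 : (0 : ℝ) < n := by exact_mod_cast hn.pos
  have h1 := hn₀ n hn
  have h2 : |birkhoffSum T h n x / n - birkhoffSum T q n x / n| ≤ e / 3 := by
    rw [← sub_div, abs_div, abs_of_pos hn0, div_le_iff₀ hn0, birkhoffSum, birkhoffSum,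
      ← Finset.sum_sub_distrib]
    refine (Finset.abs_sum_le_sum_abs _ _).trans ?_
    refine (Finset.sum_le_card_nsmul _ _ (e / 3) fun i _ => hq _).trans ?_
    simp [mul_comm]
  have h3 : |∫ x, q x ∂ν - ∫ x, h x ∂ν| ≤ e / 3 := by
    rw [← integral_sub (hint q) (show Integrable h ν from hint ⟨h, hh⟩)]
    have := norm_integral_le_of_norm_le_const (μ := ν) (f := fun y => q y - h y) (C := e / 3)
      (Eventually.of_forall fun y => by rw [Real.norm_eq_abs, abs_sub_comm]; exact hq y)
    simpa using this
  rw [Real.dist_eq, abs_lt] at *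
  rw [abs_le] at h2 h3
  constructor <;> linarith [h1.1, h1.2, h2.1, h2.2, h3.1, h3.2]

/-- Almost every orbit of an ergodic system visits a given set of positive measure infinitely
often. -/
theorem _root_.Ergodic.ae_frequently_mem {ν : Measure X} [IsFiniteMeasure ν] {T : X → X}
    (hT : Ergodic T ν) {s : Set X} (hs : MeasurableSet s) (hs0 : ν s ≠ 0) :
    ∀ᵐ x ∂ν, ∃ᶠ n in atTop, T^[n] x ∈ s := by
  have hm : MeasurableSet {x | ∃ᶠ n in atTop, T^[n] x ∈ s} := by
    have : {x | ∃ᶠ n in atTop, T^[n] x ∈ s} = limsup (fun n => T^[n] ⁻¹' s) atTop := by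
      ext x; simp [mem_limsup_iff_frequently_mem]
    rw [this]
    exact MeasurableSet.measurableSet_limsup fun n => hT.measurable.iterate n hs
  have hinv : T ⁻¹' {x | ∃ᶠ n in atTop, T^[n] x ∈ s} = {x | ∃ᶠ n in atTop, T^[n] x ∈ s} := by
    ext x
    simp only [mem_preimage, mem_ofPred_eq, ← Function.iterate_succ_apply, Nat.succ_eq_add_one]
    rw [← frequently_map (m := fun n => n + 1) (P := fun n => T^[n] x ∈ s),
      map_add_atTop_eq_nat]
  refine (hT.toPreErgodic.ae_mem_or_ae_notMem hm hinv).resolve_right fun hnot => hs0 ?_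
  refine measure_eq_zero_iff_ae_notMem.2 ?_
  filter_upwards [hnot, hT.toMeasurePreserving.conservative.ae_mem_imp_frequently_image_mem
    hs.nullMeasurableSet] with x hx hrec hxs
  exact hx (hrec hxs)

/-- For an ergodic system, an invariant set of the `N`-th iterate has measure zero or at least
`1 / N`. -/
lemma _root_.Ergodic.one_le_mul_measureReal_of_iterate {μ : Measure X} [IsProbabilityMeasure μ]
    {T : X → X} (hT : Ergodic T μ) {N : ℕ} (hN : 1 ≤ N) {B : Set X} (hB : MeasurableSet B)
    (hinv : T^[N] ⁻¹' B = B) (hB0 : μ B ≠ 0) : 1 ≤ N * μ.real B := by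
  set U : Set X := ⋃ i ∈ Finset.range N, T^[i] ⁻¹' B with hU
  have hUm : MeasurableSet U :=
    Finset.measurableSet_biUnion _ fun i _ => hT.measurable.iterate i hB
  have hUinv : T ⁻¹' U = U := by
    ext x
    simp only [hU, mem_preimage, mem_iUnion, Finset.mem_range, exists_prop,
      ← Function.iterate_succ_apply]
    have hx : T^[N] x ∈ B ↔ x ∈ B := Set.ext_iff.1 hinv x
    constructor
    · rintro ⟨i, hi, hiB⟩
      rcases (Nat.succ_le_of_lt hi).lt_or_eq with h | h
      · exact ⟨i + 1, h, hiB⟩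
      · exact ⟨0, hN, hx.1 (by rwa [← h])⟩
    · rintro ⟨i, hi, hiB⟩
      rcases i with _ | i
      · exact ⟨N - 1, by omega, by rw [Nat.succ_eq_add_one, Nat.sub_add_cancel hN]; exact hx.2 hiB⟩
      · exact ⟨i, by omega, hiB⟩
  have hBU : B ⊆ U := fun x hx =>
    mem_biUnion (x := 0) (Finset.mem_range.2 hN) (by simpa using hx)
  have hU1 : μ U = 1 :=
    (hT.toPreErgodic.prob_eq_zero_or_one hUm hUinv).resolve_left fun h =>
      hB0 (measure_mono_null hBU h)
  calc (1 : ℝ) = μ.real U := by simp [measureReal_def, hU1]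
    _ ≤ ∑ i ∈ Finset.range N, μ.real (T^[i] ⁻¹' B) := measureReal_biUnion_finset_le _ _
    _ = ∑ i ∈ Finset.range N, μ.real B := by
      refine Finset.sum_congr rfl fun i _ => ?_
      rw [measureReal_def, (hT.toMeasurePreserving.iterate i).measure_preimage
        hB.nullMeasurableSet, measureReal_def]
    _ = N * μ.real B := by simp

/-- An iterate of an ergodic map has an ergodic component on which a given function of negative
mean still has negative integral. -/
lemma _root_.Ergodic.exists_minimal_invariant_iterate {μ : Measure X} [IsProbabilityMeasure μ]
    {T : X → X} (hT : Ergodic T μ) {N : ℕ} (hN : 1 ≤ N) {u : X → ℝ} (hu : Integrable u μ)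
    (hneg : ∫ x, u x ∂μ < 0) :
    ∃ A : Set X, MeasurableSet A ∧ T^[N] ⁻¹' A = A ∧ ∫ x in A, u x ∂μ < 0 ∧
      ∀ B ⊆ A, MeasurableSet B → T^[N] ⁻¹' B = B → μ B = 0 ∨ μ (A \ B) = 0 := by
  suffices h : ∀ k : ℕ, ∀ A : Set X, MeasurableSet A → T^[N] ⁻¹' A = A →
      ∫ x in A, u x ∂μ < 0 → N * μ.real A < k →
      ∃ A : Set X, MeasurableSet A ∧ T^[N] ⁻¹' A = A ∧ ∫ x in A, u x ∂μ < 0 ∧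
        ∀ B ⊆ A, MeasurableSet B → T^[N] ⁻¹' B = B → μ B = 0 ∨ μ (A \ B) = 0 from
    h (N + 1) univ MeasurableSet.univ rfl (by simpa using hneg) (by simp)
  intro k
  induction k with
  | zero =>
    intro A _ _ _ hk
    have : 0 ≤ N * μ.real A := by positivity
    simp only [Nat.cast_zero] at hk
    linarith
  | succ k ih =>
    intro A hA hAinv hAneg hk
    by_cases hmin : ∀ B ⊆ A, MeasurableSet B → T^[N] ⁻¹' B = B → μ B = 0 ∨ μ (A \ B) = 0
    · exact ⟨A, hA, hAinv, hAneg, hmin⟩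
    push Not at hmin
    obtain ⟨B, hBA, hB, hBinv, hB0, hAB0⟩ := hmin
    have hABinv : T^[N] ⁻¹' (A \ B) = A \ B := by rw [preimage_sdiff, hAinv, hBinv]
    have h1 := hT.one_le_mul_measureReal_of_iterate hN hB hBinv hB0
    have h2 := hT.one_le_mul_measureReal_of_iterate hN (hA.diff hB) hABinv hAB0
    have h3 : μ.real (A \ B) = μ.real A - μ.real B := measureReal_sdiff hBA hB
    have h4 : ∫ x in A \ B, u x ∂μ = ∫ x in A, u x ∂μ - ∫ x in B, u x ∂μ :=
      setIntegral_sdiff hB hu.integrableOn hBA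
    push_cast at hk
    rw [h3, mul_sub] at h2
    by_cases hBneg : ∫ x in B, u x ∂μ < 0
    · exact ih B hB hBinv hBneg (by linarith)
    · exact ih (A \ B) (hA.diff hB) hABinv (by linarith) (by rw [h3, mul_sub]; linarith)

lemma _root_.Ergodic.exists_ergodic_iterate {μ : Measure X} [IsProbabilityMeasure μ]
    {T : X → X} (hT : Ergodic T μ) {N : ℕ} (hN : 1 ≤ N) {u : X → ℝ} (hu : Integrable u μ)
    (hneg : ∫ x, u x ∂μ < 0) :
    ∃ ν : Measure X, IsProbabilityMeasure ν ∧ Ergodic T^[N] ν ∧ ν ≪ μ ∧ ∫ x, u x ∂ν < 0 := by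
  obtain ⟨A, hA, hAinv, hAneg, hmin⟩ := hT.exists_minimal_invariant_iterate hN hu hneg
  have hA0 : μ A ≠ 0 := by
    intro h
    rw [Measure.restrict_eq_zero.2 h] at hAneg
    simp at hAneg
  refine ⟨ProbabilityTheory.cond μ A, ProbabilityTheory.cond_isProbabilityMeasure hA0,
    ⟨?_, ⟨?_⟩⟩, ProbabilityTheory.cond_absolutelyContinuous, ?_⟩
  · have h := (hT.toMeasurePreserving.iterate N).restrict_preimage hA
    rw [hAinv] at h
    exact h.smul_measure _
  · intro s hs hsinv
    rw [eventuallyConst_set']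
    have hinv : T^[N] ⁻¹' (A ∩ s) = A ∩ s := by rw [preimage_inter, hAinv, hsinv]
    rcases hmin (A ∩ s) inter_subset_left (hA.inter hs) hinv with h | h
    · left
      rw [ae_eq_empty, ProbabilityTheory.cond_apply hA, h, mul_zero]
    · right
      rw [ae_eq_univ, ProbabilityTheory.cond_apply hA,
        show A ∩ sᶜ = A \ (A ∩ s) by ext; simp, h, mul_zero]
  · rw [ProbabilityTheory.cond, integral_smul_measure, smul_eq_mul]
    refine mul_neg_of_pos_of_neg (ENNReal.toReal_pos ?_ ?_) hAneg
    · exact ENNReal.inv_ne_zero.2 (measure_ne_top μ A)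
    · exact ENNReal.inv_ne_top.2 hA0

end MeasureTheory

lemma exists_forall_le_mul_of_subadditive [TopologicalSpace X] [CompactSpace X]
    (f : Equiv.Perm X) {φ : ℕ → X → ℝ} (hφc : Continuous (φ 1))
    (hφsub : ∀ n m : ℕ, 1 ≤ n → 1 ≤ m → ∀ x : X, φ (n + m) x ≤ φ n x + φ m ((f ^ n) x)) :
    ∃ C : ℝ, ∀ n : ℕ, 1 ≤ n → ∀ x, φ n x ≤ n * C := by
  obtain ⟨C, hC⟩ := (isCompact_range hφc).bddAbove
  refine ⟨C, fun n hn => ?_⟩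
  induction n, hn using Nat.le_induction with
  | base => exact fun x => by simpa using hC ⟨x, rfl⟩
  | succ n hn ih =>
    intro x
    have h1 := hφsub n 1 hn le_rfl x
    have h2 : φ 1 ((f ^ n) x) ≤ C := hC ⟨_, rfl⟩
    push_cast
    linarith [ih x]

/-- If `φ n / n` is almost surely asymptotically at most `c`, then the mean of its excess over
`c` tends to zero. -/
lemma tendsto_integral_max_div_sub [TopologicalSpace X] [CompactSpace X] [MeasurableSpace X]
    [BorelSpace X] (f : Equiv.Perm X) {μ : Measure X} [IsProbabilityMeasure μ] {φ : ℕ → X → ℝ}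
    (hφc : ∀ n, 1 ≤ n → Continuous (φ n))
    (hφsub : ∀ n m : ℕ, 1 ≤ n → 1 ≤ m → ∀ x : X, φ (n + m) x ≤ φ n x + φ m ((f ^ n) x))
    {c : ℝ}
    (hφlim : ∀ᵐ x ∂μ, ∃ L : ℝ, L ≤ c ∧ Tendsto (fun n : ℕ => φ n x / n) atTop (𝓝 L)) :
    Tendsto (fun n : ℕ => ∫ x, max (φ (n + 1) x / (n + 1 : ℕ) - c) 0 ∂μ) atTop (𝓝 0) := by
  obtain ⟨C, hC⟩ := exists_forall_le_mul_of_subadditive f (hφc 1 le_rfl) hφsub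
  have h0 : ∫ _, (0 : ℝ) ∂μ = 0 := integral_zero X ℝ
  conv in 𝓝 0 => rw [← h0]
  refine tendsto_integral_of_dominated_convergence (fun _ => |C - c|) (fun n => ?_)
    (integrable_const _) (fun n => Eventually.of_forall fun x => ?_) ?_
  · have := hφc (n + 1) (by omega)
    exact (by fun_prop : Measurable _).aestronglyMeasurable
  · have hn : (0 : ℝ) < (n + 1 : ℕ) := by positivity
    have h1 : φ (n + 1) x / (n + 1 : ℕ) ≤ C := by
      rw [div_le_iff₀' hn]
      exact hC (n + 1) (by omega) x
    rw [Real.norm_eq_abs, abs_of_nonneg (le_max_right _ _)]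
    exact max_le ((sub_le_sub_right h1 c).trans (le_abs_self _)) (abs_nonneg _)
  · filter_upwards [hφlim] with x ⟨L, hL, hlim⟩
    have h := ((tendsto_add_atTop_iff_nat 1).2 hlim).sub_const c |>.max
      (tendsto_const_nhds (x := (0 : ℝ)))
    rwa [max_eq_right (sub_nonpos.2 hL)] at h

/-- Points whose forward and backward Birkhoff sums of `Φ` are all at most `K`. -/
def boundedSums (g : Equiv.Perm X) (Φ : X → ℝ) (K : ℝ) : Set X :=
  {y | ∀ j : ℕ, birkhoffSum g Φ j y ≤ K ∧ birkhoffSum g.symm Φ j (g.symm y) ≤ K}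

lemma boundedSums_mono (g : Equiv.Perm X) (Φ : X → ℝ) : Monotone (boundedSums g Φ) :=
  fun _ _ hK _ hy j => ⟨(hy j).1.trans hK, (hy j).2.trans hK⟩

lemma isClosed_boundedSums [TopologicalSpace X] {g : Equiv.Perm X} (hg : Continuous g)
    (hg' : Continuous g.symm) {Φ : X → ℝ} (hΦ : Continuous Φ) (K : ℝ) :
    IsClosed (boundedSums g Φ K) := by
  simp only [boundedSums, ofPred_forall, ofPred_and]
  refine isClosed_iInter fun j => (isClosed_le ?_ continuous_const).inter
    (isClosed_le ?_ continuous_const)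
  · exact continuous_finsetSum _ fun i _ => hΦ.comp (hg.iterate i)
  · exact continuous_finsetSum _ fun i _ => hΦ.comp ((hg'.iterate i).comp hg')

lemma ae_exists_mem_boundedSums [TopologicalSpace X] [CompactSpace X] [MeasurableSpace X]
    [BorelSpace X] {ν : Measure X} [IsProbabilityMeasure ν] {g : Equiv.Perm X}
    (hg' : Measurable g.symm) (herg : Ergodic g ν) {Φ : X → ℝ} (hΦ : Continuous Φ)
    (hneg : ∫ x, Φ x ∂ν < 0) : ∀ᵐ y ∂ν, ∃ K : ℕ, y ∈ boundedSums g Φ K := by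
  have hint : Integrable Φ ν :=
    hΦ.integrable_of_hasCompactSupport (HasCompactSupport.of_compactSpace Φ)
  let e : X ≃ᵐ X := ⟨g, herg.measurable, hg'⟩
  have herg' : Ergodic g.symm ν := Ergodic.symm (e := e) herg
  have hback := herg'.quasiErgodic.toQuasiMeasurePreserving.ae
    (ae_bddAbove_birkhoffSum herg' hΦ.measurable hint hneg)
  filter_upwards [ae_bddAbove_birkhoffSum herg hΦ.measurable hint hneg, hback]
    with y ⟨K₁, h₁⟩ ⟨K₂, h₂⟩
  obtain ⟨K, hK⟩ := exists_nat_ge (max K₁ K₂)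
  exact ⟨K, fun j => ⟨(h₁ ⟨j, rfl⟩).trans ((le_max_left _ _).trans hK),
    (h₂ ⟨j, rfl⟩).trans ((le_max_right _ _).trans hK)⟩⟩

lemma sum_Ico_add_eq_birkhoffSum (g : Equiv.Perm X) (φ : X → ℝ) (x : X) (n j : ℕ) :
    ∑ i ∈ Finset.Ico n (n + j), φ ((g ^ i) x) = birkhoffSum g φ j ((g ^ n) x) := by
  rw [Finset.sum_Ico_eq_sum_range, Nat.add_sub_cancel_left, birkhoffSum]
  refine Finset.sum_congr rfl fun i _ => ?_
  rw [Equiv.Perm.iterate_eq_pow, ← Equiv.Perm.mul_apply, ← pow_add, add_comm]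

lemma sum_Ico_sub_eq_birkhoffSum (g : Equiv.Perm X) (φ : X → ℝ) (x : X) {n j : ℕ}
    (hj : j ≤ n) :
    ∑ i ∈ Finset.Ico (n - j) n, φ ((g ^ i) x)
      = birkhoffSum g.symm φ j (g.symm ((g ^ n) x)) := by
  have hback (k : ℕ) (hk : k + 1 ≤ n) :
      g.symm^[k] (g.symm ((g ^ n) x)) = (g ^ (n - (k + 1))) x := by
    rw [← Function.iterate_succ_apply]
    have h : (g ^ n) x = g^[k + 1] ((g ^ (n - (k + 1))) x) := by
      rw [Equiv.Perm.iterate_eq_pow, ← Equiv.Perm.mul_apply, ← pow_add,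
        Nat.add_sub_cancel' hk]
    rw [h]
    exact (Function.LeftInverse.iterate g.symm_apply_apply (k + 1)) _
  rw [birkhoffSum]
  refine Finset.sum_nbij' (fun i => n - (i + 1)) (fun k => n - (k + 1)) ?_ ?_ ?_ ?_ ?_
  · intro i hi; simp only [Finset.mem_Ico, Finset.mem_range] at *; omega
  · intro i hi; simp only [Finset.mem_Ico, Finset.mem_range] at *; omega
  · intro i hi; simp only [Finset.mem_Ico] at *; omega
  · intro i hi; simp only [Finset.mem_range] at *; omega
  · intro i hi
    simp only [Finset.mem_Ico] at hi
    rw [hback _ (by omega)]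
    congr 3
    omega

lemma birkhoffSum_sub_const (T : X → X) (φ : X → ℝ) (b : ℝ) (j : ℕ) (x : X) :
    birkhoffSum T (fun y => φ y - b) j x = birkhoffSum T φ j x - j * b := by
  simp [birkhoffSum]

lemma memH_exp_of_mem_boundedSums {g : Equiv.Perm X} {x₀ : X} {φ ψ : X → ℝ} {a b K t : ℝ}
    {n : ℕ} (hφ : (g ^ n) x₀ ∈ boundedSums g (fun x => φ x - b) K)
    (hψ : (g ^ n) x₀ ∈ boundedSums g (fun x => ψ x - -a) K) (ht : Real.exp K ≤ t) :
    memH g x₀ (fun x => Real.exp (-(ψ x))) (fun x => Real.exp (φ x)) (Real.exp a) (Real.exp b)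
      t n := by
  have hF {S j : ℝ} (h : S - j * b ≤ K) : Real.exp S ≤ t * Real.exp (j * b) := by
    refine le_trans ?_ (mul_le_mul_of_nonneg_right ht (Real.exp_pos _).le)
    rw [← Real.exp_add]
    exact Real.exp_le_exp.2 (by linarith)
  have hE {S j : ℝ} (h : S - j * -a ≤ K) : Real.exp (j * a) ≤ t * Real.exp (-S) := by
    refine le_trans ?_ (mul_le_mul_of_nonneg_right ht (Real.exp_pos _).le)
    rw [← Real.exp_add]
    exact Real.exp_le_exp.2 (by linarith)
  simp only [memH, ← Real.exp_sum, ← Real.exp_nat_mul, Finset.sum_neg_distrib]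
  simp only [boundedSums, mem_ofPred_eq, birkhoffSum_sub_const] at hφ hψ
  refine ⟨fun j hj => ?_, fun j => ?_⟩
  · rw [sum_Ico_sub_eq_birkhoffSum g φ x₀ hj, sum_Ico_sub_eq_birkhoffSum g ψ x₀ hj]
    exact ⟨hF (hφ j).2, hE (hψ j).2⟩
  · rw [sum_Ico_add_eq_birkhoffSum, sum_Ico_add_eq_birkhoffSum]
    exact ⟨hF (hφ j).1, hE (hψ j).1⟩

/-- If the orbit of `x₀` visits every basic open set meeting `G` in positive measure infinitely
often inside `G`, then it accumulates on almost all of `G` through `G`. -/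
lemma mem_block_of_mem_support [TopologicalSpace X] [SecondCountableTopology X]
    [MeasurableSpace X] {ν : Measure X} {g : Equiv.Perm X} {x₀ : X} {G : Set X}
    (hG : MeasurableSet G)
    (hfreq : ∀ U ∈ TopologicalSpace.countableBasis X, ν (U ∩ G) ≠ 0 →
      ∃ᶠ n in atTop, (g ^ n) x₀ ∈ U ∩ G)
    {φE φF : X → ℝ} {cE cF t : ℝ}
    (hH : ∀ n, (g ^ n) x₀ ∈ G → memH g x₀ φE φF cE cF t n) {y : X}
    (hy : y ∈ (ν.restrict G).support) : y ∈ block g x₀ φE φF cE cF t := by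
  refine mem_iInter₂.2 fun m _ => ?_
  rw [(TopologicalSpace.isBasis_countableBasis X).mem_closure_iff]
  intro U hU hyU
  have hUo := TopologicalSpace.isOpen_of_mem_countableBasis hU
  have hpos := (Measure.mem_support_iff_forall y).1 hy U (hUo.mem_nhds hyU)
  rw [Measure.restrict_apply' hG] at hpos
  obtain ⟨n, hmn, hn⟩ := frequently_atTop.1 (hfreq U hU hpos.ne') m
  exact ⟨(g ^ n) x₀, hn.1, n, ⟨hH n hn.2, hmn⟩, rfl⟩

/-- If the normalised functions have negative mean, then for almost every base point the
resonance blocks exhaust the space in measure. -/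
theorem ae_measure_block [MetricSpace X] [CompactSpace X] [MeasurableSpace X] [BorelSpace X]
    {ν : Measure X} [IsProbabilityMeasure ν] {g : Equiv.Perm X} (hg : Continuous g)
    (hg' : Continuous g.symm) (herg : Ergodic g ν) {φ ψ : X → ℝ} (hφ : Continuous φ)
    (hψ : Continuous ψ) {a b : ℝ} (hφneg : ∫ x, (φ x - b) ∂ν < 0)
    (hψneg : ∫ x, (ψ x - -a) ∂ν < 0) :
    ∀ᵐ x₀ ∂ν,
      ν (blockUnion g x₀ (fun x => Real.exp (-(ψ x))) (fun x => Real.exp (φ x))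
        (Real.exp a) (Real.exp b)) = 1 ∧
      Tendsto (fun t : ℝ => ν (block g x₀ (fun x => Real.exp (-(ψ x)))
        (fun x => Real.exp (φ x)) (Real.exp a) (Real.exp b) t)) atTop (𝓝 1) := by
  have hφ' : Continuous fun x => φ x - b := hφ.sub continuous_const
  have hψ' : Continuous fun x => ψ x - -a := hψ.sub continuous_const
  set G : ℕ → Set X := fun K =>
    boundedSums g (fun x => φ x - b) K ∩ boundedSums g (fun x => ψ x - -a) K with hGdef
  have hGm (K : ℕ) : MeasurableSet (G K) :=
    ((isClosed_boundedSums hg hg' hφ' K).inter (isClosed_boundedSums hg hg' hψ' K)).measurableSet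
  have hGmono : Monotone G := fun K L hKL =>
    inter_subset_inter (boundedSums_mono g _ (Nat.cast_le.2 hKL))
      (boundedSums_mono g _ (Nat.cast_le.2 hKL))
  have hGunion : ν (⋃ K, G K) = 1 := by
    rw [← mem_ae_iff_prob_eq_one (MeasurableSet.iUnion hGm)]
    filter_upwards [ae_exists_mem_boundedSums hg'.measurable herg hφ' hφneg,
      ae_exists_mem_boundedSums hg'.measurable herg hψ' hψneg] with y ⟨K, hK⟩ ⟨L, hL⟩
    exact mem_iUnion.2 ⟨max K L, boundedSums_mono g _ (Nat.cast_le.2 (le_max_left K L)) hK,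
      boundedSums_mono g _ (Nat.cast_le.2 (le_max_right K L)) hL⟩
  have hGlim : Tendsto (fun K => ν (G K)) atTop (𝓝 1) :=
    hGunion ▸ tendsto_measure_iUnion_atTop hGmono
  have hfreq : ∀ᵐ x₀ ∂ν, ∀ K, ∀ U ∈ TopologicalSpace.countableBasis X, ν (U ∩ G K) ≠ 0 →
      ∃ᶠ n in atTop, (g ^ n) x₀ ∈ U ∩ G K := by
    rw [ae_all_iff]
    intro K
    rw [ae_ball_iff (TopologicalSpace.countable_countableBasis X)]
    intro U hU
    by_cases h0 : ν (U ∩ G K) = 0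
    · simp [h0]
    have hUm := (TopologicalSpace.isOpen_of_mem_countableBasis hU).measurableSet
    filter_upwards [herg.ae_frequently_mem (hUm.inter (hGm K)) h0] with x hx _
    simpa only [Equiv.Perm.iterate_eq_pow] using hx
  filter_upwards [hfreq] with x₀ hx₀
  have hle {t : ℝ} {K : ℕ} (ht : Real.exp K ≤ t) : ν (G K) ≤
      ν (block g x₀ (fun x => Real.exp (-(ψ x))) (fun x => Real.exp (φ x))
        (Real.exp a) (Real.exp b) t) := by
    have hsub : (ν.restrict (G K)).support ⊆
        block g x₀ (fun x => Real.exp (-(ψ x))) (fun x => Real.exp (φ x))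
          (Real.exp a) (Real.exp b) t := fun y hy =>
      mem_block_of_mem_support (hGm K) (hx₀ K)
        (fun n hn => memH_exp_of_mem_boundedSums hn.1 hn.2 ht) hy
    calc ν (G K) = (ν.restrict (G K)) univ := (Measure.restrict_apply_univ _).symm
      _ = (ν.restrict (G K)) (ν.restrict (G K)).support :=
        (measure_congr (eventuallyEq_univ.2 Measure.support_mem_ae)).symm
      _ ≤ ν (ν.restrict (G K)).support := Measure.restrict_apply_le _ _
      _ ≤ _ := measure_mono hsub
  constructor
  · refine le_antisymm prob_le_one (le_of_tendsto' hGlim fun K => ?_)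
    refine (hle le_rfl).trans (measure_mono ?_)
    exact subset_biUnion_of_mem (u := block g x₀ _ _ _ _)
      (show Real.exp K ∈ {t : ℝ | 1 ≤ t} from Real.one_le_exp K.cast_nonneg)
  · have hfloor : Tendsto (fun t : ℝ => ⌊Real.log t⌋₊) atTop atTop :=
      tendsto_nat_floor_atTop.comp Real.tendsto_log_atTop
    refine tendsto_of_tendsto_of_tendsto_of_le_of_le' (hGlim.comp hfloor) tendsto_const_nhds ?_
      (Eventually.of_forall fun t => prob_le_one)
    filter_upwards [eventually_ge_atTop 1] with t ht
    refine hle ?_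
    rw [← Real.le_log_iff_exp_le (by linarith)]
    exact Nat.floor_le (Real.log_nonneg ht)

/-- Proposition 3.11: given two subadditive sequences of continuous functions with a.e.
asymptotic averages at most `χ_F` and `−χ_E` respectively, for every `ε > 0` there are
`N ≥ 1`, an `f^N`-invariant ergodic measure `ν ≪ μ`, and a `ν`-generic point `x₀`, such
that the resonance blocks built from `(f^N, x₀, e^{−ψ_N}, e^{φ_N}, e^{N(χ_E−ε)},
e^{N(χ_F+ε)})` satisfy `ν(⋃_{t≥1} Λ_t) = 1` and `ν(Λ_t) → 1` as `t → ∞`. -/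
theorem stmt_10 [MetricSpace X] [CompactSpace X] [MeasurableSpace X] [BorelSpace X]
    (f : Equiv.Perm X) (hf : Continuous ⇑f) (hf' : Continuous ⇑f.symm)
    (μ : Measure X) [IsProbabilityMeasure μ] (herg : Ergodic (⇑f) μ)
    (φ ψ : ℕ → X → ℝ)
    (hφc : ∀ n, 1 ≤ n → Continuous (φ n)) (hψc : ∀ n, 1 ≤ n → Continuous (ψ n))
    (hφsub : ∀ n m : ℕ, 1 ≤ n → 1 ≤ m → ∀ x : X, φ (n + m) x ≤ φ n x + φ m ((f ^ n) x))
    (hψsub : ∀ n m : ℕ, 1 ≤ n → 1 ≤ m → ∀ x : X, ψ (n + m) x ≤ ψ n x + ψ m ((f ^ n) x))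
    (χF χE : ℝ)
    (hφlim : ∀ᵐ x ∂μ, ∃ L : ℝ, L ≤ χF ∧ Tendsto (fun n : ℕ => φ n x / n) atTop (𝓝 L))
    (hψlim : ∀ᵐ x ∂μ, ∃ L : ℝ, L ≤ -χE ∧ Tendsto (fun n : ℕ => ψ n x / n) atTop (𝓝 L)) :
    ∀ ε : ℝ, 0 < ε → ∃ N : ℕ, 1 ≤ N ∧ ∃ ν : Measure X, IsProbabilityMeasure ν ∧
      MeasurePreserving (⇑(f ^ N)) ν ν ∧ Ergodic (⇑(f ^ N)) ν ∧ ν ≪ μ ∧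
      ∃ x₀ : X,
        (∀ h : X → ℝ, Continuous h →
          Tendsto (fun n : ℕ => (∑ i ∈ Finset.range n, h (((f ^ N) ^ i) x₀)) / (n : ℝ))
            atTop (𝓝 (∫ x, h x ∂ν))) ∧
        ν (blockUnion (f ^ N) x₀ (fun x => Real.exp (-(ψ N x))) (fun x => Real.exp (φ N x))
            (Real.exp (N * (χE - ε))) (Real.exp (N * (χF + ε)))) = 1 ∧
        Tendsto (fun t : ℝ =>
            ν (block (f ^ N) x₀ (fun x => Real.exp (-(ψ N x))) (fun x => Real.exp (φ N x))
              (Real.exp (N * (χE - ε))) (Real.exp (N * (χF + ε))) t)) atTop (𝓝 1) := by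
  intro ε hε
  have hint {h : X → ℝ} (hh : Continuous h) (ν : Measure X) [IsProbabilityMeasure ν] :
      Integrable h ν := hh.integrable_of_hasCompactSupport (HasCompactSupport.of_compactSpace h)
  have hlim := (tendsto_integral_max_div_sub f hφc hφsub hφlim).add
    (tendsto_integral_max_div_sub f hψc hψsub hψlim)
  rw [add_zero] at hlim
  obtain ⟨n, hn⟩ := (hlim.eventually_lt_const hε).exists
  set N := n + 1 with hN
  have hN1 : 1 ≤ N := by omega
  have hN0 : (0 : ℝ) < N := by positivity
  have hφN := hφc N hN1
  have hψN := hψc N hN1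
  have hcφ : Continuous fun x => max (φ N x / N - χF) 0 := by fun_prop
  have hcψ : Continuous fun x => max (ψ N x / N - -χE) 0 := by fun_prop
  set u : X → ℝ := fun x => max (φ N x / N - χF) 0 + max (ψ N x / N - -χE) 0 - ε with hu
  have huc : Continuous u := by fun_prop
  have huneg : ∫ x, u x ∂μ < 0 := by
    have h := integral_sub ((hint hcφ μ).add (hint hcψ μ)) (integrable_const ε)
    simp only [Pi.add_apply, integral_add (hint hcφ μ) (hint hcψ μ), integral_const,
      probReal_univ, one_smul] at h
    simp only [hu]
    linarith
  obtain ⟨ν, hν, hνerg, hνμ, hνneg⟩ := herg.exists_ergodic_iterate hN1 (hint huc μ) huneg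
  rw [Equiv.Perm.iterate_eq_pow] at hνerg
  have hneg {θ : X → ℝ} (hθ : Continuous θ) {c : ℝ} (hle : ∀ x, θ x / N - c - ε ≤ u x) :
      ∫ x, (θ x - N * (c + ε)) ∂ν < 0 := by
    have hc : Continuous fun x => θ x - N * (c + ε) := by fun_prop
    refine (integral_mono (hint hc ν) ((hint huc ν).const_mul (N : ℝ)) fun x => ?_).trans_lt ?_
    · have h := mul_le_mul_of_nonneg_left (hle x) hN0.le
      have h' : N * (θ x / N - c - ε) = θ x - N * (c + ε) := by field_simp; ring
      simpa only [h'] using h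
    · rw [integral_const_mul]
      exact mul_neg_of_pos_of_neg hN0 hνneg
  have hφneg : ∫ x, (φ N x - N * (χF + ε)) ∂ν < 0 := hneg hφN fun x => by
    simp only [hu]
    linarith [le_max_left (φ N x / N - χF) 0, le_max_right (ψ N x / N - -χE) 0]
  have hψneg : ∫ x, (ψ N x - -(N * (χE - ε))) ∂ν < 0 := by
    have h := hneg hψN (c := -χE) fun x => by
      simp only [hu]
      linarith [le_max_right (φ N x / N - χF) 0, le_max_left (ψ N x / N - -χE) 0]
    rwa [show (N : ℝ) * (-χE + ε) = -(N * (χE - ε)) by ring] at h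
  have hg : Continuous ⇑(f ^ N) := Equiv.Perm.iterate_eq_pow f N ▸ hf.iterate N
  have hg' : Continuous ⇑(f ^ N).symm := by
    have h : (f ^ N).symm = f.symm ^ N := (inv_pow f N).symm
    rw [h, ← Equiv.Perm.iterate_eq_pow]
    exact hf'.iterate N
  obtain ⟨x₀, hx₀, hblock⟩ := ((ae_forall_continuous_tendsto_birkhoffSum_div hνerg).and
    (ae_measure_block hg hg' hνerg hφN hψN hφneg hψneg)).exists
  refine ⟨N, hN1, ν, hν, hνerg.toMeasurePreserving, hνerg, hνμ, x₀, fun h hh => ?_, hblock⟩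
  simpa only [birkhoffSum, Equiv.Perm.iterate_eq_pow] using hx₀ h hh
end
end

section
/- Let X be a compact metric space, g : X → X a homeomorphism, x₀ ∈ X, ℓ ≥ 1 an integer, and for each 1 ≤ j ≤ ℓ let m_j, M_j : X → (0,∞) be continuous functions with m_j(x) ≤ M_j(x) for all x, and let 0 < c_j⁻ ≤ c_j⁺ be constants. For n ∈ ℕ define a¹_n = sup_{0 ≤ k ≤ n} max_{1 ≤ j ≤ ℓ} max( ∏_{i=n−k}^{n−1} M_j(gⁱ(x₀)) / (c_j⁺)^k , (c_j⁻)^k / ∏_{i=n−k}^{n−1} m_j(gⁱ(x₀)) ) and a²_n = sup_{k ≥ 0} max_{1 ≤ j ≤ ℓ} max( ∏_{i=n}^{n+k−1} M_j(gⁱ(x₀)) / (c_j⁺)^k , (c_j⁻)^k / ∏_{i=n}^{n+k−1} m_j(gⁱ(x₀)) ) (empty products equal 1). For real t ≥ 1 set H_t = {n ∈ ℕ : a¹_n ≤ t and a²_n ≤ t}, Λ_t = ⋂_{m ≥ 1} closure({gʲ(x₀) : j ∈ H_t, j ≥ m}), R = ⋃_{t ≥ 1} Λ_t and T(x) = inf{t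 ≥ 1 : x ∈ Λ_t} for x ∈ R. Then for every x ∈ R, every integer k ≥ 1 and every 1 ≤ j ≤ ℓ: (1) T(x)⁻¹ · (c_j⁻)^k ≤ ∏_{i=−k}^{−1} m_j(gⁱ(x)) ≤ ∏_{i=−k}^{−1} M_j(gⁱ(x)) ≤ T(x) · (c_j⁺)^k, and (2) T(x)⁻¹ · (c_j⁻)^k ≤ ∏_{i=0}^{k−1} m_j(gⁱ(x)) ≤ ∏_{i=0}^{k−1} M_j(gⁱ(x)) ≤ T(x) · (c_j⁺)^k. (Proposition 6.2 of the paper, stated for the abstract multi-bundle resonance-block construction.) -/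
open Set Filter Topology

noncomputable section

variable {X : Type*}

/-- `n ∈ H_t` for the multi-bundle resonance-block construction:
`a¹_n ≤ t ∧ a²_n ≤ t` (all defining ratios bounded by `t`). -/
def memHM {ℓ : ℕ} (g : Equiv.Perm X) (x₀ : X) (m M : Fin ℓ → X → ℝ)
    (cm cp : Fin ℓ → ℝ) (t : ℝ) (n : ℕ) : Prop :=
  (∀ k ≤ n, ∀ j : Fin ℓ,
      (∏ i ∈ Finset.Ico (n - k) n, M j ((g ^ i) x₀)) ≤ t * cp j ^ k ∧
      cm j ^ k ≤ t * ∏ i ∈ Finset.Ico (n - k) n, m j ((g ^ i) x₀)) ∧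
  (∀ k : ℕ, ∀ j : Fin ℓ,
      (∏ i ∈ Finset.Ico n (n + k), M j ((g ^ i) x₀)) ≤ t * cp j ^ k ∧
      cm j ^ k ≤ t * ∏ i ∈ Finset.Ico n (n + k), m j ((g ^ i) x₀))

/-- The multi-bundle resonance block `Λ_t`. -/
def blockM [TopologicalSpace X] {ℓ : ℕ} (g : Equiv.Perm X) (x₀ : X)
    (m M : Fin ℓ → X → ℝ) (cm cp : Fin ℓ → ℝ) (t : ℝ) : Set X :=
  ⋂ k ∈ {k : ℕ | 1 ≤ k},
    closure ((fun j : ℕ => (g ^ j) x₀) '' {j | memHM g x₀ m M cm cp t j ∧ k ≤ j})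

/-- `R = ⋃_{t ≥ 1} Λ_t`. -/
def blockUnionM [TopologicalSpace X] {ℓ : ℕ} (g : Equiv.Perm X) (x₀ : X)
    (m M : Fin ℓ → X → ℝ) (cm cp : Fin ℓ → ℝ) : Set X :=
  ⋃ t ∈ {t : ℝ | 1 ≤ t}, blockM g x₀ m M cm cp t

/-- `T(x) = inf {t ≥ 1 : x ∈ Λ_t}`. -/
def TfunM [TopologicalSpace X] {ℓ : ℕ} (g : Equiv.Perm X) (x₀ : X)
    (m M : Fin ℓ → X → ℝ) (cm cp : Fin ℓ → ℝ) (x : X) : ℝ :=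
  sInf {t : ℝ | 1 ≤ t ∧ x ∈ blockM g x₀ m M cm cp t}

lemma Equiv.Perm.continuous_pow [TopologicalSpace X] {g : Equiv.Perm X} (hg : Continuous ⇑g)
    (n : ℕ) : Continuous ⇑(g ^ n) := by
  rw [← Equiv.Perm.iterate_eq_pow]
  exact hg.iterate n

lemma Equiv.Perm.continuous_zpow_neg [TopologicalSpace X] {g : Equiv.Perm X}
    (hg : Continuous ⇑g.symm) (n : ℕ) : Continuous ⇑(g ^ (-(n : ℤ))) := by
  rw [zpow_neg, zpow_natCast, ← inv_pow]
  exact Equiv.Perm.continuous_pow (g := g⁻¹) hg n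

/-- Forward products along the orbit of `g ^ n` as products over an interval of times. -/
lemma prod_range_orbit (g : Equiv.Perm X) (φ : X → ℝ) (x₀ : X) (n k : ℕ) :
    ∏ i ∈ Finset.range k, φ ((g ^ i) ((g ^ n) x₀))
      = ∏ i ∈ Finset.Ico n (n + k), φ ((g ^ i) x₀) := by
  rw [Finset.prod_Ico_eq_prod_range, Nat.add_sub_cancel_left]
  refine Finset.prod_congr rfl fun i _ => ?_
  rw [← Equiv.Perm.mul_apply, ← pow_add, add_comm]

/-- Backward products along the orbit of `g ^ n` as products over an interval of times. -/
lemma prod_Icc_orbit (g : Equiv.Perm X) (φ : X → ℝ) (x₀ : X) {n k : ℕ} (hk : k ≤ n) :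
    ∏ i ∈ Finset.Icc 1 k, φ ((g ^ (-(i : ℤ))) ((g ^ n) x₀))
      = ∏ i ∈ Finset.Ico (n - k) n, φ ((g ^ i) x₀) := by
  refine Finset.prod_nbij' (fun i => n - i) (fun i => n - i) ?_ ?_ ?_ ?_ ?_
  iterate 4
    intro i hi
    simp only [Finset.mem_Icc, Finset.mem_Ico] at hi ⊢
    omega
  intro i hi
  have hin : i ≤ n := (Finset.mem_Icc.1 hi).2.trans hk
  rw [← Equiv.Perm.mul_apply, ← zpow_natCast g n, ← zpow_add, ← zpow_natCast g (n - i),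
    Nat.cast_sub hin, neg_add_eq_sub]

/-- A closed condition satisfied by all orbit points with time in `H_t`, from some time on,
holds on the whole block `Λ_t`. -/
lemma blockM_subset_of_isClosed [TopologicalSpace X] {ℓ : ℕ} {g : Equiv.Perm X} {x₀ : X}
    {m M : Fin ℓ → X → ℝ} {cm cp : Fin ℓ → ℝ} {t : ℝ} {C : Set X} (hC : IsClosed C) {k : ℕ}
    (hk : 1 ≤ k) (h : ∀ n, memHM g x₀ m M cm cp t n → k ≤ n → (g ^ n) x₀ ∈ C) :
    blockM g x₀ m M cm cp t ⊆ C := by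
  refine (biInter_subset_of_mem (show k ∈ {k : ℕ | 1 ≤ k} from hk)).trans
    (closure_minimal ?_ hC)
  rintro _ ⟨n, ⟨hn, hkn⟩, rfl⟩
  exact h n hn hkn

/-- The infimum in the definition of `T` may be taken in inequalities linear in `t`. -/
lemma le_TfunM_mul [TopologicalSpace X] {ℓ : ℕ} {g : Equiv.Perm X} {x₀ : X}
    {m M : Fin ℓ → X → ℝ} {cm cp : Fin ℓ → ℝ} {x : X} (hx : x ∈ blockUnionM g x₀ m M cm cp)
    {a c : ℝ} (hc : 0 < c) (h : ∀ t, x ∈ blockM g x₀ m M cm cp t → a ≤ t * c) :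
    a ≤ TfunM g x₀ m M cm cp x * c := by
  obtain ⟨t, ht, hxt⟩ := mem_iUnion₂.1 hx
  rw [← div_le_iff₀ hc]
  exact le_csInf ⟨t, ht, hxt⟩ fun s hs => (div_le_iff₀ hc).2 (h s hs.2)

lemma TfunM_pos [TopologicalSpace X] {ℓ : ℕ} {g : Equiv.Perm X} {x₀ : X}
    {m M : Fin ℓ → X → ℝ} {cm cp : Fin ℓ → ℝ} {x : X}
    (hx : x ∈ blockUnionM g x₀ m M cm cp) : 0 < TfunM g x₀ m M cm cp x := by
  obtain ⟨t, ht, hxt⟩ := mem_iUnion₂.1 hx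
  exact one_pos.trans_le (le_csInf ⟨t, ht, hxt⟩ fun s hs => hs.1)

/-- Proposition 6.2: for every `x ∈ R`, `k ≥ 1` and `1 ≤ j ≤ ℓ`, the backward and
forward products of `m_j` and `M_j` along the orbit of `x` are pinched between
`T(x)⁻¹·(c_j⁻)^k` and `T(x)·(c_j⁺)^k`. -/
theorem stmt_11 [MetricSpace X] [CompactSpace X]
    (g : Equiv.Perm X) (hg : Continuous ⇑g) (hg' : Continuous ⇑g.symm)
    (x₀ : X) (ℓ : ℕ) (hℓ : 1 ≤ ℓ)
    (m M : Fin ℓ → X → ℝ)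
    (hmc : ∀ j, Continuous (m j)) (hMc : ∀ j, Continuous (M j))
    (hmpos : ∀ j x, 0 < m j x) (hmM : ∀ j x, m j x ≤ M j x)
    (cm cp : Fin ℓ → ℝ) (hcm : ∀ j, 0 < cm j) (hcmcp : ∀ j, cm j ≤ cp j) :
    ∀ x ∈ blockUnionM g x₀ m M cm cp, ∀ k : ℕ, 1 ≤ k → ∀ j : Fin ℓ,
      ((TfunM g x₀ m M cm cp x)⁻¹ * cm j ^ k
          ≤ ∏ i ∈ Finset.Icc 1 k, m j ((g ^ (-(i : ℤ))) x) ∧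
        (∏ i ∈ Finset.Icc 1 k, m j ((g ^ (-(i : ℤ))) x))
          ≤ ∏ i ∈ Finset.Icc 1 k, M j ((g ^ (-(i : ℤ))) x) ∧
        (∏ i ∈ Finset.Icc 1 k, M j ((g ^ (-(i : ℤ))) x))
          ≤ TfunM g x₀ m M cm cp x * cp j ^ k) ∧
      ((TfunM g x₀ m M cm cp x)⁻¹ * cm j ^ k
          ≤ ∏ i ∈ Finset.range k, m j ((g ^ i) x) ∧
        (∏ i ∈ Finset.range k, m j ((g ^ i) x))
          ≤ ∏ i ∈ Finset.range k, M j ((g ^ i) x) ∧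
        (∏ i ∈ Finset.range k, M j ((g ^ i) x))
          ≤ TfunM g x₀ m M cm cp x * cp j ^ k) := by
  intro x hx k hk j
  have hT := TfunM_pos hx
  have hcp : 0 < cp j ^ k := pow_pos ((hcm j).trans_le (hcmcp j)) k
  have hback (φ : X → ℝ) (hφ : Continuous φ) :
      Continuous fun y => ∏ i ∈ Finset.Icc 1 k, φ ((g ^ (-(i : ℤ))) y) :=
    continuous_finsetProd _ fun i _ => hφ.comp (Equiv.Perm.continuous_zpow_neg hg' i)
  have hforw (φ : X → ℝ) (hφ : Continuous φ) :
      Continuous fun y => ∏ i ∈ Finset.range k, φ ((g ^ i) y) :=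
    continuous_finsetProd _ fun i _ => hφ.comp (Equiv.Perm.continuous_pow hg i)
  refine ⟨⟨?_, ?_, ?_⟩, ?_, ?_, ?_⟩
  · rw [inv_mul_le_iff₀ hT]
    refine le_TfunM_mul hx (Finset.prod_pos fun i _ => hmpos j _) fun t ht => ?_
    refine blockM_subset_of_isClosed (C := {y | cm j ^ k ≤ t * _})
      (isClosed_le continuous_const (continuous_const.mul (hback _ (hmc j)))) hk
      (fun n hn hkn => ?_) ht
    rw [mem_ofPred_eq, prod_Icc_orbit g (m j) x₀ hkn]
    exact (hn.1 k hkn j).2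
  · exact Finset.prod_le_prod (fun i _ => (hmpos j _).le) fun i _ => hmM j _
  · refine le_TfunM_mul hx hcp fun t ht => ?_
    refine blockM_subset_of_isClosed (C := {y | _ ≤ t * cp j ^ k})
      (isClosed_le (hback _ (hMc j)) continuous_const) hk (fun n hn hkn => ?_) ht
    rw [mem_ofPred_eq, prod_Icc_orbit g (M j) x₀ hkn]
    exact (hn.1 k hkn j).1
  · rw [inv_mul_le_iff₀ hT]
    refine le_TfunM_mul hx (Finset.prod_pos fun i _ => hmpos j _) fun t ht => ?_
    refine blockM_subset_of_isClosed (C := {y | cm j ^ k ≤ t * _})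
      (isClosed_le continuous_const (continuous_const.mul (hforw _ (hmc j)))) hk
      (fun n hn _ => ?_) ht
    rw [mem_ofPred_eq, prod_range_orbit g (m j) x₀]
    exact (hn.2 k j).2
  · exact Finset.prod_le_prod (fun i _ => (hmpos j _).le) fun i _ => hmM j _
  · refine le_TfunM_mul hx hcp fun t ht => ?_
    refine blockM_subset_of_isClosed (C := {y | _ ≤ t * cp j ^ k})
      (isClosed_le (hforw _ (hMc j)) continuous_const) hk (fun n hn _ => ?_) ht
    rw [mem_ofPred_eq, prod_range_orbit g (M j) x₀]
    exact (hn.2 k j).1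
end
end
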